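/- arXiv:1608.00831 — 5 statements merged into one kernel-verified Lean document; each statement's English description precedes it below -/
import Mathlib

section
/- Quadrature error of the fractional linear multistep method on monomials (Lemma 2.2): Let 0<β<1, ν ≥ 0, and T>0. Then there exists a constant C>0, depending only on β, ν and T, such that for every step size h>0 and every integer n ≥ 1 with t_n = nh ≤ T, setting t_k = kh, one has |Γ(ν+1)/Γ(ν+1+β) · t_n^{ν+β} − h^β Σ_{k=0}^{n} ω_{n−k}^{(β)} t_k^{ν}| ≤ C(h^2 t_n^{ν+β−2} + h^{1+ν} t_n^{β−1}). (Here Γ(ν+1)/Γ(ν+1+β)·t_n^{ν+β} = (I_0^β u)(t_n) for u(t) = t^ν.) -/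
/-- Generalized binomial coefficient `C(β,i) = β(β−1)⋯(β−i+1)/i!`. -/
noncomputable def genBinom (β : ℝ) (i : ℕ) : ℝ :=
  (∏ j ∈ Finset.range i, (β - (j : ℝ))) / (Nat.factorial i : ℝ)

/-- Taylor coefficients of the generating function `((1+z)/(2(1−z)))^β`. -/
noncomputable def omegaCoef (β : ℝ) (j : ℕ) : ℝ :=
  (2 : ℝ) ^ (-β) * ∑ i ∈ Finset.range (j + 1),
    genBinom β i * Real.Gamma (β + ((j - i : ℕ) : ℝ)) /
      (Real.Gamma β * (Nat.factorial (j - i) : ℝ))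

open Filter Topology Asymptotics PowerSeries

theorem choose_eq_genBinom (β : ℝ) (n : ℕ) : Ring.choose β n = genBinom β n := by
  rw [genBinom, Ring.choose_eq_smul, Polynomial.descPochhammer_smeval_eq_ascPochhammer,
    Polynomial.ascPochhammer_smeval_cast, Polynomial.ascPochhammer_smeval_eq_eval,
    ← descPochhammer_eval_eq_ascPochhammer, descPochhammer_eval_eq_prod_range, smul_eq_mul,
    div_eq_inv_mul]

/-- The power series `(1 - X) ^ (-α)`. -/
noncomputable def oneSubPow (α : ℝ) : PowerSeries ℝ :=
  rescale (-1) (PowerSeries.binomialSeries ℝ (-α))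

theorem oneSubPow_add (α γ : ℝ) : oneSubPow (α + γ) = oneSubPow α * oneSubPow γ := by
  simp [oneSubPow, add_comm (-γ), map_mul]

theorem oneSubPow_neg_one : oneSubPow (-1) = 1 - X := by
  have h := PowerSeries.binomialSeries_nat (R := ℝ) (A := ℝ) 1
  simp only [Nat.cast_one, pow_one] at h
  simp [oneSubPow, h, rescale_X, sub_eq_add_neg]

theorem oneSubPow_zero : oneSubPow 0 = 1 := by
  simp [oneSubPow]

theorem coeff_oneSubPow (α : ℝ) (n : ℕ) :
    coeff n (oneSubPow α) = (∏ j ∈ Finset.range n, (α + j)) / n.factorial := by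
  simp only [oneSubPow, coeff_rescale, PowerSeries.binomialSeries_coeff, smul_eq_mul, mul_one,
    choose_eq_genBinom, genBinom, ← mul_div_assoc]
  congr 1
  conv_lhs => enter [1]; rw [← Finset.card_range n, ← Finset.prod_const]
  rw [← Finset.prod_mul_distrib]
  exact Finset.prod_congr rfl fun j _ => by ring

theorem coeff_oneSubPow_succ (α : ℝ) (n : ℕ) :
    (n + 1) * coeff (n + 1) (oneSubPow α) = (α + n) * coeff n (oneSubPow α) := by
  simp only [coeff_oneSubPow, Finset.prod_range_succ, Nat.factorial_succ]
  push_cast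
  have : (n.factorial : ℝ) ≠ 0 := by positivity
  field_simp

theorem coeff_oneSubPow_add_one (α : ℝ) (n : ℕ) :
    α * coeff n (oneSubPow (α + 1)) = (α + n) * coeff n (oneSubPow α) := by
  induction n with
  | zero => simp [coeff_oneSubPow]
  | succ n ih =>
    have h1 := coeff_oneSubPow_succ (α + 1) n
    have h2 := coeff_oneSubPow_succ α n
    have h3 : (n + 1 : ℝ) ≠ 0 := by positivity
    apply mul_left_cancel₀ h3
    push_cast
    linear_combination α * h1 + (α + 1 + n) * ih - (α + n + 1) * h2

theorem coeff_oneSubPow_eq_gamma {α : ℝ} (hα : 0 < α) (n : ℕ) :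
    coeff n (oneSubPow α) = Real.Gamma (α + n) / (Real.Gamma α * n.factorial) := by
  induction n with
  | zero => simp [coeff_oneSubPow, (Real.Gamma_pos_of_pos hα).ne']
  | succ n ih =>
    have h3 : (n + 1 : ℝ) ≠ 0 := by positivity
    have h4 : (n.factorial : ℝ) ≠ 0 := by positivity
    have h5 := (Real.Gamma_pos_of_pos hα).ne'
    apply mul_left_cancel₀ h3
    rw [coeff_oneSubPow_succ, ih, Nat.factorial_succ]
    push_cast
    rw [← add_assoc, Real.Gamma_add_one (by positivity)]
    field_simp

theorem coeff_oneSubPow_pos {α : ℝ} (hα : 0 < α) (n : ℕ) : 0 < coeff n (oneSubPow α) := by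
  rw [coeff_oneSubPow]
  have : ∀ j ∈ Finset.range n, 0 < α + (j : ℝ) := fun j _ => by positivity
  have := Finset.prod_pos this
  positivity

/-- The coefficients of `F` are `O((n + 1) ^ p)`. -/
def CoeffDecay (F : PowerSeries ℝ) (p : ℝ) : Prop :=
  ∃ C, 0 ≤ C ∧ ∀ n, |coeff n F| ≤ C * (n + 1 : ℝ) ^ p

namespace CoeffDecay

variable {F G : PowerSeries ℝ} {p q : ℝ}

theorem of_isBigO (h : (fun n : ℕ => coeff n F) =O[atTop] fun n : ℕ => (n + 1 : ℝ) ^ p) :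
    CoeffDecay F p := by
  obtain ⟨C, hC, h⟩ := bound_of_isBigO_nat_atTop h
  refine ⟨C, hC.le, fun n => ?_⟩
  have hn : 0 < (n + 1 : ℝ) ^ p := by positivity
  simpa [abs_of_pos hn] using h hn.ne'

theorem mono (h : CoeffDecay F p) (hpq : p ≤ q) : CoeffDecay F q := by
  obtain ⟨C, hC, h⟩ := h
  exact ⟨C, hC, fun n => (h n).trans (by gcongr; linarith [n.cast_nonneg (α := ℝ)])⟩

theorem add (hF : CoeffDecay F p) (hG : CoeffDecay G p) : CoeffDecay (F + G) p := by
  obtain ⟨C, hC, hF⟩ := hF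
  obtain ⟨D, hD, hG⟩ := hG
  refine ⟨C + D, by positivity, fun n => ?_⟩
  rw [map_add, add_mul]
  exact (abs_add_le _ _).trans (add_le_add (hF n) (hG n))

theorem smul (hF : CoeffDecay F p) (c : ℝ) : CoeffDecay (c • F) p := by
  obtain ⟨C, hC, hF⟩ := hF
  refine ⟨|c| * C, by positivity, fun n => ?_⟩
  rw [map_smul, smul_eq_mul, abs_mul, mul_assoc]
  exact mul_le_mul_of_nonneg_left (hF n) (abs_nonneg c)

theorem sub (hF : CoeffDecay F p) (hG : CoeffDecay G p) : CoeffDecay (F - G) p := by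
  simpa [sub_eq_add_neg] using hF.add (hG.smul (-1))

theorem zero (p : ℝ) : CoeffDecay 0 p :=
  ⟨0, le_rfl, fun n => by simp⟩

end CoeffDecay

theorem abs_coeff_mul_le {F G : PowerSeries ℝ} {C D p q : ℝ} (hC : 0 ≤ C)
    (hF : ∀ n, |coeff n F| ≤ C * (n + 1 : ℝ) ^ p)
    (hG : ∀ n, |coeff n G| ≤ D * (n + 1 : ℝ) ^ q) (n : ℕ) :
    |coeff n (F * G)| ≤ C * D *
      ∑ x ∈ Finset.HasAntidiagonal.antidiagonal n, (x.1 + 1 : ℝ) ^ p * (x.2 + 1 : ℝ) ^ q := by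
  rw [coeff_mul, Finset.mul_sum]
  refine (Finset.abs_sum_le_sum_abs _ _).trans (Finset.sum_le_sum fun x _ => ?_)
  rw [abs_mul]
  calc _ ≤ (C * (x.1 + 1 : ℝ) ^ p) * (D * (x.2 + 1 : ℝ) ^ q) :=
        mul_le_mul (hF _) (hG _) (abs_nonneg _) (by positivity)
    _ = _ := by ring

theorem tendsto_coeff_oneSubPow (α : ℝ) (hα : 0 < α) :
    Tendsto (fun n : ℕ => Real.Gamma α * coeff n (oneSubPow α) / (n : ℝ) ^ (α - 1))
      atTop (𝓝 1) := by
  have hΓ := (Real.Gamma_pos_of_pos hα).ne'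
  have h1 : Tendsto (fun n : ℕ => Real.Gamma α * ((n : ℝ) / (n + α) / Real.GammaSeq α n))
      atTop (𝓝 (Real.Gamma α * (1 / Real.Gamma α))) :=
    ((tendsto_natCast_div_add_atTop α).div (Real.GammaSeq_tendsto_Gamma α) hΓ).const_mul _
  rw [mul_one_div_cancel hΓ] at h1
  refine h1.congr' ?_
  filter_upwards [eventually_gt_atTop 0] with n hn
  have hn' : (0 : ℝ) < n := by exact_mod_cast hn
  have hp : 0 < ∏ j ∈ Finset.range n, (α + (j : ℝ)) :=
    Finset.prod_pos fun j _ => by positivity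
  rw [coeff_oneSubPow, Real.GammaSeq, Finset.prod_range_succ, Real.rpow_sub_one hn'.ne']
  have := Real.rpow_pos_of_pos hn' α
  have h4 : (n.factorial : ℝ) ≠ 0 := by positivity
  have h5 : (n : ℝ) + α ≠ 0 := by positivity
  field_simp
  ring

theorem isTheta_natCast_add_one_rpow (p : ℝ) :
    (fun n : ℕ => (n : ℝ) ^ p) =Θ[atTop] fun n : ℕ => (n + 1 : ℝ) ^ p := by
  have h : (fun n : ℕ => (n : ℝ)) ~[atTop] fun n : ℕ => (n + 1 : ℝ) := by
    rw [isEquivalent_iff_tendsto_one]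
    · exact tendsto_natCast_div_add_atTop 1
    · exact Eventually.of_forall fun n => by positivity
  exact (h.rpow (r := p) fun n => by positivity).isTheta

theorem isTheta_coeff_oneSubPow {α : ℝ} (hα : 0 < α) :
    (fun n : ℕ => coeff n (oneSubPow α)) =Θ[atTop] fun n : ℕ => (n + 1 : ℝ) ^ (α - 1) := by
  refine IsTheta.trans ?_ (isTheta_natCast_add_one_rpow _)
  have hΓ := (Real.Gamma_pos_of_pos hα).ne'
  have h : (fun n : ℕ => Real.Gamma α * coeff n (oneSubPow α)) ~[atTop]
      fun n : ℕ => (n : ℝ) ^ (α - 1) := by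
    rw [isEquivalent_iff_tendsto_one]
    · exact tendsto_coeff_oneSubPow α hα
    · filter_upwards [eventually_gt_atTop 0] with n hn
      have hn' : (0 : ℝ) < n := by exact_mod_cast hn
      positivity
  exact (isTheta_const_mul_left hΓ).1 h.isTheta

theorem coeffDecay_oneSubPow_of_pos {α : ℝ} (hα : 0 < α) :
    CoeffDecay (oneSubPow α) (α - 1) :=
  .of_isBigO (isTheta_coeff_oneSubPow hα).1

theorem exists_rpow_le_coeff_oneSubPow {α : ℝ} (hα : 0 < α) :
    ∃ C, 0 ≤ C ∧ ∀ n : ℕ, (n + 1 : ℝ) ^ (α - 1) ≤ C * coeff n (oneSubPow α) := by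
  obtain ⟨C, hC, h⟩ := bound_of_isBigO_nat_atTop (isTheta_coeff_oneSubPow hα).2
  refine ⟨C, hC.le, fun n => ?_⟩
  have hn := coeff_oneSubPow_pos hα n
  have hn' : 0 < (n + 1 : ℝ) ^ (α - 1) := by positivity
  simpa [abs_of_pos hn, abs_of_pos hn'] using h hn.ne'

theorem coeffDecay_oneSubPow {α : ℝ} (hα : -1 < α) : CoeffDecay (oneSubPow α) (α - 1) := by
  refine .of_isBigO ?_
  have h1 := (isTheta_coeff_oneSubPow (α := α + 1) (by linarith)).1
  have h2 : (fun n : ℕ => α / (α + n)) =O[atTop] fun n : ℕ => (n + 1 : ℝ) ^ (-1 : ℝ) := by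
    refine IsBigO.of_bound (3 * |α|) ?_
    filter_upwards [eventually_ge_atTop 2] with n hn
    have hn' : (2 : ℝ) ≤ n := by exact_mod_cast hn
    have h3 : 0 < α + n := by linarith
    rw [Real.rpow_neg_one, norm_div, norm_inv, Real.norm_eq_abs, Real.norm_eq_abs,
      Real.norm_eq_abs, abs_of_pos h3, abs_of_pos (by linarith : (0 : ℝ) < n + 1), div_le_iff₀ h3,
      mul_assoc, mul_comm 3, mul_assoc]
    refine le_mul_of_one_le_right (abs_nonneg _) ?_
    rw [mul_comm, mul_assoc, inv_mul_eq_div, one_le_div (by linarith)]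
    linarith
  refine (h2.mul h1).congr' ?_ ?_
  · filter_upwards [eventually_ge_atTop 2] with n hn
    have hn' : (2 : ℝ) ≤ n := by exact_mod_cast hn
    have h3 : α + n ≠ 0 := by linarith
    have := coeff_oneSubPow_add_one α n
    field_simp
    linarith
  · filter_upwards with n
    rw [← Real.rpow_add (by positivity)]
    ring_nf

theorem one_add_rpow_sub_taylor_isBigO (μ : ℝ) :
    (fun y : ℝ => (1 + y) ^ μ - (1 + μ * y + μ * (μ - 1) / 2 * y ^ 2)) =O[𝓝 0]
      fun y : ℝ => y ^ 3 := by
  have h := (Real.one_add_rpow_hasFPowerSeriesAt_zero (a := μ)).isBigO_sub_partialSum_pow 3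
  refine (h.congr (fun y => ?_) (fun y => ?_)).trans (isBigO_refl _ _).norm_left
  · simp [FormalMultilinearSeries.partialSum, Finset.sum_range_succ, choose_eq_genBinom, genBinom,
      Finset.prod_range_succ, _root_.binomialSeries, FormalMultilinearSeries.coeff_ofScalars]
    ring
  · simp

theorem sub_isBigO_of_succ_sub_isBigO {v : ℕ → ℝ} {l : ℝ} (hv : Tendsto v atTop (𝓝 l))
    (h : (fun n => v (n + 1) - v n) =O[atTop] fun n : ℕ => ((n : ℝ) ^ 3)⁻¹) :
    (fun n => v n - l) =O[atTop] fun n : ℕ => ((n : ℝ) ^ 2)⁻¹ := by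
  obtain ⟨C, hC, h⟩ := h.exists_pos
  obtain ⟨N, hN⟩ := eventually_atTop.1 h.bound
  have hstep : ∀ n ≥ N + 1, |v (n + 1) - v n| ≤
      2 * C * ((n : ℝ) ^ 2)⁻¹ - 2 * C * (((n + 1 : ℕ) : ℝ) ^ 2)⁻¹ := by
    intro n hn
    have hn' : (1 : ℝ) ≤ n := by exact_mod_cast (by omega : 1 ≤ n)
    have h1 := hN n (by omega)
    rw [Real.norm_eq_abs, Real.norm_of_nonneg (by positivity)] at h1
    refine h1.trans ?_
    rw [mul_assoc, mul_assoc, ← mul_sub, ← mul_sub, mul_left_comm]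
    refine mul_le_mul_of_nonneg_left ?_ hC.le
    push_cast
    rw [inv_sub_inv (by positivity) (by positivity), ← mul_div_assoc, ← one_div,
      div_le_div_iff₀ (by positivity) (by positivity)]
    nlinarith [pow_pos (by linarith : (0 : ℝ) < n) 3, pow_pos (by linarith : (0 : ℝ) < n) 2,
      pow_pos (by linarith : (0 : ℝ) < n) 4]
  have hlim : Tendsto (fun n : ℕ => 2 * C * ((n : ℝ) ^ 2)⁻¹) atTop (𝓝 0) := by
    have := (tendsto_pow_atTop (α := ℝ) (n := 2) (by norm_num)).comp
      (tendsto_natCast_atTop_atTop (R := ℝ))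
    simpa using this.inv_tendsto_atTop.const_mul (2 * C)
  have hshift : Tendsto (fun n => n + (N + 1)) atTop atTop := tendsto_add_atTop_nat (N + 1)
  have hmono : Monotone fun n => v (n + (N + 1)) - 2 * C * (((n + (N + 1) : ℕ) : ℝ) ^ 2)⁻¹ := by
    refine monotone_nat_of_le_succ fun n => ?_
    have := (abs_le.1 (hstep (n + (N + 1)) (by omega))).1
    rw [show n + 1 + (N + 1) = n + (N + 1) + 1 by ring]
    linarith
  have hanti : Antitone fun n => v (n + (N + 1)) + 2 * C * (((n + (N + 1) : ℕ) : ℝ) ^ 2)⁻¹ := by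
    refine antitone_nat_of_succ_le fun n => ?_
    have := (abs_le.1 (hstep (n + (N + 1)) (by omega))).2
    rw [show n + 1 + (N + 1) = n + (N + 1) + 1 by ring]
    linarith
  refine IsBigO.of_bound (2 * C) ?_
  filter_upwards [eventually_ge_atTop (N + 1)] with n hn
  obtain ⟨m, rfl⟩ := Nat.exists_eq_add_of_le' hn
  have h1 := hmono.ge_of_tendsto ((hv.sub hlim).comp hshift) m
  have h2 := hanti.le_of_tendsto ((hv.add hlim).comp hshift) m
  rw [Real.norm_eq_abs, Real.norm_of_nonneg (by positivity), abs_le]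
  constructor <;> linarith

/-- Second-order expansion of `n ^ ν` in coefficients of powers of `1 - X`. -/
theorem rpow_sub_coeff_isBigO {ν : ℝ} (hν : 0 ≤ ν) :
    (fun n : ℕ => (n : ℝ) ^ ν - Real.Gamma (ν + 1) *
      (coeff n (oneSubPow (ν + 1)) - (ν + 1) / 2 * coeff n (oneSubPow ν))) =O[atTop]
      fun n : ℕ => (n : ℝ) ^ (ν - 2) := by
  set s : ℝ := ν * (ν + 1) / 2 with hs
  set g : ℕ → ℝ := fun n => Real.Gamma (ν + 1) * coeff n (oneSubPow (ν + 1)) / (n : ℝ) ^ ν with hg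
  set v : ℕ → ℝ := fun n => g n * (1 - s / (n + ν)) with hv
  have hglim : Tendsto g atTop (𝓝 1) := by
    simpa using tendsto_coeff_oneSubPow (ν + 1) (by linarith)
  have hvlim : Tendsto v atTop (𝓝 1) := by
    have h1 : Tendsto (fun n : ℕ => s / ((n : ℝ) + ν)) atTop (𝓝 0) :=
      (tendsto_atTop_add_const_right _ ν tendsto_natCast_atTop_atTop).const_div_atTop s
    simpa using hglim.mul (h1.const_sub 1)
  have hstep : (fun n => v (n + 1) - v n) =O[atTop] fun n : ℕ => ((n : ℝ) ^ 3)⁻¹ := by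
    set ψ : ℝ → ℝ := fun y =>
      (1 + (1 + ν - s) * y) * (1 + ν * y) - (1 + (ν - s) * y) * (1 + y) ^ (ν + 1) with hψ
    have hψO : ψ =O[𝓝 0] fun y : ℝ => y ^ 3 := by
      have h1 := one_add_rpow_sub_taylor_isBigO (ν + 1)
      have h2 : (fun y : ℝ => 1 + (ν - s) * y) =O[𝓝 0] fun _ => (1 : ℝ) :=
        (Continuous.tendsto (by fun_prop) 0).isBigO_one ℝ
      have h3 := (h2.mul h1).neg_left
      have h4 : (fun y : ℝ => (-(ν - s) * s) * y ^ 3) =O[𝓝 0] fun y : ℝ => y ^ 3 :=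
        (isBigO_refl _ _).const_mul_left _
      refine ((h3.congr_right fun y => one_mul _).add h4).congr_left fun y => ?_
      simp only [hψ, hs]
      ring
    have hinv : Tendsto (fun n : ℕ => ((n : ℝ))⁻¹) atTop (𝓝 0) := tendsto_inv_atTop_nhds_zero_nat
    have h1 : (fun n : ℕ => g n * ψ ((n : ℝ)⁻¹)) =O[atTop] fun n : ℕ => ((n : ℝ) ^ 3)⁻¹ :=
      ((hglim.isBigO_one ℝ).mul (hψO.comp_tendsto hinv)).congr_right fun n => by simp
    refine IsBigO.trans (IsBigO.of_bound 1 ?_) h1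
    filter_upwards [eventually_gt_atTop 0] with n hn
    have hn' : (0 : ℝ) < n := by exact_mod_cast hn
    set y : ℝ := (n : ℝ)⁻¹ with hy
    have hy0 : 0 < y := inv_pos.2 hn'
    have hny : (n : ℝ) = y⁻¹ := by simp [hy]
    have hpow : ((n : ℝ) + 1) ^ ν = (n : ℝ) ^ ν * (1 + y) ^ ν := by
      rw [← Real.mul_rpow hn'.le (by positivity)]
      congr 1
      rw [hny]
      field_simp
    have hc := coeff_oneSubPow_succ (ν + 1) n
    have hc' : coeff (n + 1) (oneSubPow (ν + 1)) =
        (ν + 1 + n) / (n + 1) * coeff n (oneSubPow (ν + 1)) := by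
      field_simp
      linarith
    have hp : 0 < (1 + y) ^ ν := by positivity
    have hpn : 0 < (n : ℝ) ^ ν := by positivity
    have hkey : v (n + 1) - v n = g n * ψ y / ((1 + y) ^ (ν + 1) * (1 + ν * y)) := by
      simp only [hv, hg, hψ]
      push_cast
      rw [hc', hpow, Real.rpow_add_one (by positivity)]
      have e1 : (ν + 1 + n) / ((n : ℝ) + 1) = (1 + (1 + ν) * y) / (1 + y) := by
        rw [hny]; field_simp; ring
      have e2 : s / ((n : ℝ) + 1 + ν) = s * y / (1 + (1 + ν) * y) := by
        rw [hny]; field_simp; ring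
      have e3 : s / ((n : ℝ) + ν) = s * y / (1 + ν * y) := by
        rw [hny]; field_simp
      have p1 : 1 + (1 + ν) * y ≠ 0 := by positivity
      have p2 : 1 + ν * y ≠ 0 := by positivity
      rw [e1, e2, e3]
      generalize (n : ℝ) ^ ν = A at *
      generalize (1 + y) ^ ν = B at *
      field_simp
      ring
    rw [hkey, one_mul, norm_div]
    refine div_le_self (norm_nonneg _) ?_
    have q1 : 1 ≤ (1 + y) ^ (ν + 1) := Real.one_le_rpow (by linarith) (by linarith)
    have q2 : 1 ≤ 1 + ν * y := by nlinarith
    rw [Real.norm_of_nonneg (by positivity)]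
    exact one_le_mul_of_one_le_of_one_le q1 q2
  have h := (sub_isBigO_of_succ_sub_isBigO hvlim hstep).neg_left
  refine ((isBigO_refl (fun n : ℕ => (n : ℝ) ^ ν) atTop).mul h).congr' ?_ ?_
  · filter_upwards [eventually_gt_atTop 0] with n hn
    have hn' : (0 : ℝ) < n := by exact_mod_cast hn
    have hpn : 0 < (n : ℝ) ^ ν := by positivity
    have hc := coeff_oneSubPow_add_one ν n
    have hc' : coeff n (oneSubPow ν) = ν * coeff n (oneSubPow (ν + 1)) / (n + ν) := by
      rw [eq_div_iff (by positivity)]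
      linarith
    simp only [hv, hg, hc', hs]
    have : (n : ℝ) + ν ≠ 0 := by positivity
    field_simp
    ring
  · filter_upwards [eventually_gt_atTop 0] with n hn
    have hn' : (0 : ℝ) < n := by exact_mod_cast hn
    rw [Real.rpow_sub hn', div_eq_mul_inv]
    norm_num

theorem exists_sum_antidiagonal_rpow_le {p q : ℝ} (hp : -1 < p) (hq : -1 < q) :
    ∃ C, 0 ≤ C ∧ ∀ n : ℕ, ∑ x ∈ Finset.HasAntidiagonal.antidiagonal n,
      (x.1 + 1 : ℝ) ^ p * (x.2 + 1 : ℝ) ^ q ≤ C * (n + 1 : ℝ) ^ (p + q + 1) := by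
  obtain ⟨A, hA, hpA⟩ := exists_rpow_le_coeff_oneSubPow (α := p + 1) (by linarith)
  obtain ⟨B, hB, hqB⟩ := exists_rpow_le_coeff_oneSubPow (α := q + 1) (by linarith)
  obtain ⟨D, hD, hpq⟩ := coeffDecay_oneSubPow_of_pos (α := (p + 1) + (q + 1)) (by linarith)
  simp only [add_sub_cancel_right] at hpA hqB
  refine ⟨A * B * D, by positivity, fun n => ?_⟩
  calc _ ≤ ∑ x ∈ Finset.HasAntidiagonal.antidiagonal n,
        (A * coeff x.1 (oneSubPow (p + 1))) * (B * coeff x.2 (oneSubPow (q + 1))) := by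
        refine Finset.sum_le_sum fun x _ => ?_
        exact mul_le_mul (hpA _) (hqB _) (by positivity) ((by positivity : (0 : ℝ) ≤ _).trans (hpA _))
    _ = A * B * coeff n (oneSubPow ((p + 1) + (q + 1))) := by
        rw [oneSubPow_add (p + 1) (q + 1), coeff_mul, Finset.mul_sum]
        exact Finset.sum_congr rfl fun x _ => by ring
    _ ≤ A * B * (D * (n + 1 : ℝ) ^ (p + 1 + (q + 1) - 1)) :=
        mul_le_mul_of_nonneg_left ((le_abs_self _).trans (hpq n)) (by positivity)
    _ = _ := by rw [mul_assoc, mul_assoc, mul_assoc]; ring_nf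

theorem rpow_le_two_rpow_abs_mul {m N : ℝ} (p : ℝ) (hm : 0 < m) (hmN : m ≤ N) (hN : N ≤ 2 * m) :
    m ^ p ≤ 2 ^ |p| * N ^ p := by
  rcases le_total 0 p with hp | hp
  · refine (Real.rpow_le_rpow hm.le hmN hp).trans ?_
    exact le_mul_of_one_le_left (Real.rpow_nonneg (hm.le.trans hmN) p) (Real.one_le_rpow (by norm_num) (abs_nonneg p))
  · rw [abs_of_nonpos hp, Real.rpow_neg (by norm_num), ← div_eq_inv_mul,
      ← Real.div_rpow (by linarith) (by norm_num)]
    exact Real.rpow_le_rpow_of_nonpos (by linarith) (by linarith) hp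

theorem exists_sum_antidiagonal_rpow_le_of_summable {p q : ℝ} (hp : p < -1) (hq : -1 < q) :
    ∃ C, 0 ≤ C ∧ ∀ n : ℕ, ∑ x ∈ Finset.HasAntidiagonal.antidiagonal n,
      (x.1 + 1 : ℝ) ^ p * (x.2 + 1 : ℝ) ^ q ≤ C * (n + 1 : ℝ) ^ q := by
  obtain ⟨A, hA, hsum⟩ := exists_sum_antidiagonal_rpow_le (p := 0) (by norm_num) hq
  simp only [Real.rpow_zero, one_mul, zero_add] at hsum
  have hS : Summable fun n : ℕ => (n + 1 : ℝ) ^ p := by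
    have := (summable_nat_add_iff 1).2 (Real.summable_nat_rpow.2 hp)
    simpa using this
  set S := ∑' n : ℕ, (n + 1 : ℝ) ^ p
  have hS0 : 0 ≤ S := tsum_nonneg fun n => by positivity
  refine ⟨2 ^ |q| * S + 2 ^ |p| * A, by positivity, fun n => ?_⟩
  calc _ ≤ ∑ x ∈ Finset.HasAntidiagonal.antidiagonal n,
        (2 ^ |q| * (n + 1 : ℝ) ^ q * (x.1 + 1 : ℝ) ^ p +
          2 ^ |p| * (n + 1 : ℝ)⁻¹ * (x.2 + 1 : ℝ) ^ q) := by
        refine Finset.sum_le_sum fun x hx => ?_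
        have hx' : (x.1 : ℝ) + x.2 = n := by
          exact_mod_cast Finset.HasAntidiagonal.mem_antidiagonal.1 hx
        have h1 : (0 : ℝ) ≤ x.1 := by positivity
        have h2 : (0 : ℝ) ≤ x.2 := by positivity
        rcases le_total (n + 1 : ℝ) (2 * (x.2 + 1)) with h | h
        · have := rpow_le_two_rpow_abs_mul q (by linarith) (by linarith) h
          refine le_add_of_le_of_nonneg ?_ (by positivity)
          rw [mul_comm]
          gcongr
        · have := rpow_le_two_rpow_abs_mul (m := x.1 + 1) (N := n + 1) p (by linarith)
            (by linarith) (by linarith)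
          refine le_add_of_nonneg_of_le (by positivity) ?_
          gcongr
          refine this.trans ?_
          rw [← Real.rpow_neg_one]
          gcongr
          linarith
    _ = 2 ^ |q| * (n + 1 : ℝ) ^ q * ∑ k ∈ Finset.range (n + 1), (k + 1 : ℝ) ^ p +
          2 ^ |p| * (n + 1 : ℝ)⁻¹ * ∑ x ∈ Finset.HasAntidiagonal.antidiagonal n,
            (x.2 + 1 : ℝ) ^ q := by
        rw [Finset.sum_add_distrib, ← Finset.mul_sum, ← Finset.mul_sum,
          Finset.Nat.sum_antidiagonal_eq_sum_range_succ (fun i _ => ((i : ℝ) + 1) ^ p) n]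
    _ ≤ 2 ^ |q| * (n + 1 : ℝ) ^ q * S +
          2 ^ |p| * (n + 1 : ℝ)⁻¹ * (A * (n + 1 : ℝ) ^ (q + 1)) := by
        gcongr
        · exact hS.sum_le_tsum _ fun i _ => by positivity
        · exact hsum n
    _ = _ := by
        rw [Real.rpow_add_one (by positivity)]
        field_simp

namespace CoeffDecay

variable {F G : PowerSeries ℝ} {p q : ℝ}

theorem mul (hF : CoeffDecay F p) (hG : CoeffDecay G q) (hp : -1 < p) (hq : -1 < q) :
    CoeffDecay (F * G) (p + q + 1) := by
  obtain ⟨C, hC, hF⟩ := hF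
  obtain ⟨D, hD, hG⟩ := hG
  obtain ⟨A, hA, h⟩ := exists_sum_antidiagonal_rpow_le hp hq
  refine ⟨C * D * A, by positivity, fun n => (abs_coeff_mul_le hC hF hG n).trans ?_⟩
  rw [mul_assoc _ A]
  exact mul_le_mul_of_nonneg_left (h n) (by positivity)

theorem mul_of_summable (hF : CoeffDecay F p) (hG : CoeffDecay G q) (hp : p < -1) (hq : -1 < q) :
    CoeffDecay (F * G) q := by
  obtain ⟨C, hC, hF⟩ := hF
  obtain ⟨D, hD, hG⟩ := hG
  obtain ⟨A, hA, h⟩ := exists_sum_antidiagonal_rpow_le_of_summable hp hq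
  refine ⟨C * D * A, by positivity, fun n => (abs_coeff_mul_le hC hF hG n).trans ?_⟩
  rw [mul_assoc _ A]
  exact mul_le_mul_of_nonneg_left (h n) (by positivity)

end CoeffDecay

theorem coeff_oneSubPow_eq_choose (α : ℝ) (n : ℕ) :
    coeff n (oneSubPow α) = (-1) ^ n * Ring.choose (-α) n := by
  simp [oneSubPow]

theorem coeff_oneSubPow_neg_natCast (m i : ℕ) :
    coeff i (oneSubPow (-(m : ℝ))) = (-1) ^ i * (m.choose i : ℝ) := by
  rw [coeff_oneSubPow_eq_choose, neg_neg, Ring.choose_natCast]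

theorem sum_range_choose_mul_half_pow_le (i M : ℕ) :
    ∑ m ∈ Finset.range M, (m.choose i : ℝ) * (1 / 2) ^ m ≤ 2 := by
  induction i generalizing M with
  | zero =>
    simp only [Nat.choose_zero_right, Nat.cast_one, one_mul]
    exact (summable_geometric_two.sum_le_tsum _ fun _ _ => by positivity).trans_eq
      tsum_geometric_two
  | succ i ih =>
    have hmono : ∑ m ∈ Finset.range M, (m.choose (i + 1) : ℝ) * (1 / 2) ^ m ≤
        ∑ m ∈ Finset.range (M + 1), (m.choose (i + 1) : ℝ) * (1 / 2) ^ m := by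
      rw [Finset.sum_range_succ]
      exact le_add_of_nonneg_right (by positivity)
    have hrec : ∑ m ∈ Finset.range (M + 1), (m.choose (i + 1) : ℝ) * (1 / 2) ^ m =
        1 / 2 * ∑ m ∈ Finset.range M, (m.choose i : ℝ) * (1 / 2) ^ m +
        1 / 2 * ∑ m ∈ Finset.range M, (m.choose (i + 1) : ℝ) * (1 / 2) ^ m := by
      rw [Finset.sum_range_succ', Finset.mul_sum, Finset.mul_sum, ← Finset.sum_add_distrib]
      simp only [Nat.choose_zero_succ, Nat.cast_zero, zero_mul, add_zero]
      refine Finset.sum_congr rfl fun m _ => ?_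
      rw [Nat.choose_succ_succ, pow_succ]
      push_cast
      ring
    linarith [ih M]

/-- Expansion of `((1 + X) / 2) ^ β = (1 - (1 - X) / 2) ^ β` in powers of `(1 - X) / 2`. -/
theorem tendsto_coeff_sum_oneSubPow (β : ℝ) (i : ℕ) :
    Tendsto (fun M => coeff i (∑ m ∈ Finset.range M,
      (coeff m (oneSubPow (-β)) * (1 / 2) ^ m) • oneSubPow (-(m : ℝ)))) atTop
      (𝓝 (coeff i ((2 : ℝ) ^ (-β) • PowerSeries.binomialSeries ℝ β))) := by
  have h := (Real.one_add_rpow_hasFPowerSeriesOnBall_zero (a := β - i)).hasSum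
    (y := -(1 / 2 : ℝ)) (by
      rw [Metric.mem_eball, edist_dist, ← ENNReal.ofReal_one]
      exact (ENNReal.ofReal_lt_ofReal_iff one_pos).2 (by norm_num [Real.dist_eq]))
  simp only [binomialSeries_apply, List.ofFn_const, List.prod_replicate, smul_eq_mul] at h
  have h2 : HasSum (fun m : ℕ => coeff m (oneSubPow (-β)) * (1 / 2) ^ m *
      ((-1) ^ i * (m.choose i : ℝ))) ((2 : ℝ) ^ (-β) * Ring.choose β i) := by
    have h0 : ∑ m ∈ Finset.range i, coeff m (oneSubPow (-β)) * (1 / 2) ^ m *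
        ((-1) ^ i * (m.choose i : ℝ)) = 0 :=
      Finset.sum_eq_zero fun m hm => by
        simp [Nat.choose_eq_zero_of_lt (Finset.mem_range.1 hm)]
    rw [← add_zero ((2 : ℝ) ^ (-β) * _), ← h0, ← hasSum_nat_add_iff]
    have hval : (2 : ℝ) ^ (-β) * Ring.choose β i =
        (1 / 2) ^ i * Ring.choose β i * (1 + (0 + -(1 / 2))) ^ (β - i) := by
      rw [show (1 : ℝ) + (0 + -(1 / 2)) = 2⁻¹ by norm_num, Real.inv_rpow (by norm_num),
        ← Real.rpow_neg (by norm_num), neg_sub, Real.rpow_sub (by norm_num), Real.rpow_natCast,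
        Real.rpow_neg (by norm_num)]
      have : (2 : ℝ) ^ β ≠ 0 := by positivity
      rw [one_div, inv_pow]
      field_simp
    rw [hval]
    have hsum := h.mul_left ((1 / 2) ^ i * Ring.choose β i)
    convert! hsum using 2 with k
    have hch := Ring.choose_smul_choose β (Nat.le_add_left i k)
    rw [Nat.add_sub_cancel, nsmul_eq_mul] at hch
    have hs : (-1 : ℝ) ^ (k + i) * (-1) ^ i = (-1) ^ k := by
      rw [pow_add, mul_assoc, ← mul_pow]
      norm_num
    rw [coeff_oneSubPow_eq_choose, neg_neg, neg_pow (1 / 2 : ℝ) k, ← hs, pow_add (1 / 2 : ℝ)]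
    linear_combination ((-1 : ℝ) ^ (k + i) * (-1) ^ i * (1 / 2) ^ k * (1 / 2) ^ i) * hch
  have h3 := h2.tendsto_sum_nat
  simpa [coeff_oneSubPow_neg_natCast] using h3

theorem coeffDecay_of_tendsto {F : ℕ → PowerSeries ℝ} {G : PowerSeries ℝ} {p C : ℝ} (hC : 0 ≤ C)
    (hF : ∀ M n, |coeff n (F M)| ≤ C * (n + 1 : ℝ) ^ p)
    (h : ∀ n, Tendsto (fun M => coeff n (F M)) atTop (𝓝 (coeff n G))) : CoeffDecay G p :=
  ⟨C, hC, fun n => le_of_tendsto (h n).abs (Eventually.of_forall fun M => hF M n)⟩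

/-- The second-order Taylor remainder of `((1 + X) / 2) ^ β` at `X = 1`. -/
noncomputable def taylorRemainder (β : ℝ) : PowerSeries ℝ :=
  ((2 : ℝ) ^ (-β) • PowerSeries.binomialSeries ℝ β - oneSubPow 0 + (β / 2) • oneSubPow (-1)) *
    oneSubPow 2

theorem smul_binomialSeries_eq (β : ℝ) :
    (2 : ℝ) ^ (-β) • PowerSeries.binomialSeries ℝ β =
      1 - (β / 2) • oneSubPow (-1) + oneSubPow (-2) * taylorRemainder β := by
  have h : oneSubPow (-2) * oneSubPow 2 = 1 := by rw [← oneSubPow_add]; simp [oneSubPow_zero]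
  rw [taylorRemainder, mul_left_comm, h, oneSubPow_zero]
  ring

theorem coeffDecay_taylorRemainder {β : ℝ} (hβ0 : 0 < β) (hβ1 : β < 1) :
    CoeffDecay (taylorRemainder β) (-β - 1) := by
  obtain ⟨C, hC, hc⟩ := coeffDecay_oneSubPow (α := -β) (by linarith)
  let R : ℕ → PowerSeries ℝ := fun M => ∑ m ∈ Finset.range M,
    (coeff (m + 2) (oneSubPow (-β)) * (1 / 2) ^ (m + 2)) • oneSubPow (-(m : ℝ))
  have hR : ∀ M, R M = (∑ m ∈ Finset.range (M + 2),
      (coeff m (oneSubPow (-β)) * (1 / 2) ^ m) • oneSubPow (-(m : ℝ)) - oneSubPow 0 +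
        (β / 2) • oneSubPow (-1)) * oneSubPow 2 := by
    intro M
    have h0 : coeff 0 (oneSubPow (-β)) = 1 := by simp [coeff_oneSubPow]
    have h1 : coeff 1 (oneSubPow (-β)) = -β := by simp [coeff_oneSubPow]
    rw [Finset.sum_range_succ', Finset.sum_range_succ', zero_add, h0, h1]
    have h2 : ∀ m : ℕ, oneSubPow (-((m + 1 + 1 : ℕ) : ℝ)) * oneSubPow 2 = oneSubPow (-(m : ℝ)) := by
      intro m
      rw [← oneSubPow_add]
      push_cast
      ring_nf
    have h3 : R M = (∑ m ∈ Finset.range M, (coeff (m + 2) (oneSubPow (-β)) * (1 / 2) ^ (m + 2)) •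
        oneSubPow (-((m + 1 + 1 : ℕ) : ℝ))) * oneSubPow 2 := by
      rw [Finset.sum_mul]
      exact Finset.sum_congr rfl fun m _ => by rw [smul_mul_assoc, h2]
    rw [h3]
    congr 1
    simp only [Nat.cast_zero, Nat.cast_one, neg_zero, pow_zero, pow_one, mul_one, one_smul]
    module
  refine coeffDecay_of_tendsto (F := R) (C := C) hC (fun M n => ?_) (fun n => ?_)
  · simp only [R, map_sum, map_smul, smul_eq_mul, coeff_oneSubPow_neg_natCast]
    calc _ ≤ ∑ m ∈ Finset.range M, C * (n + 1 : ℝ) ^ (-β - 1) / 4 *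
          ((m.choose n : ℝ) * (1 / 2) ^ m) := by
          refine (Finset.abs_sum_le_sum_abs _ _).trans (Finset.sum_le_sum fun m _ => ?_)
          rcases lt_or_ge m n with hmn | hmn
          · simp [Nat.choose_eq_zero_of_lt hmn]
          · have hle : |coeff (m + 2) (oneSubPow (-β))| ≤ C * (n + 1 : ℝ) ^ (-β - 1) := by
              refine (hc _).trans (mul_le_mul_of_nonneg_left ?_ hC)
              refine Real.rpow_le_rpow_of_nonpos (by positivity) ?_ (by linarith)
              have : (n : ℝ) ≤ m := by exact_mod_cast hmn
              push_cast
              linarith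
            rw [abs_mul, abs_mul, abs_mul, abs_pow, abs_pow, abs_neg, abs_one, one_pow, one_mul,
              Nat.abs_cast, abs_of_pos (by norm_num : (0 : ℝ) < 1 / 2), pow_add]
            have h0 : (0 : ℝ) ≤ (m.choose n : ℝ) * (1 / 2) ^ m := by positivity
            nlinarith [mul_le_mul_of_nonneg_right hle h0]
      _ ≤ C * (n + 1 : ℝ) ^ (-β - 1) / 4 * 2 := by
          rw [← Finset.mul_sum]
          exact mul_le_mul_of_nonneg_left (sum_range_choose_mul_half_pow_le n M) (by positivity)
      _ ≤ _ := by
          have : 0 ≤ C * (n + 1 : ℝ) ^ (-β - 1) := by positivity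
          linarith
  · simp only [hR, taylorRemainder, coeff_mul, map_add, map_sub]
    refine tendsto_finsetSum _ fun x _ => ?_
    exact ((((tendsto_coeff_sum_oneSubPow β x.1).comp (tendsto_add_atTop_nat 2)).sub_const
      _).add_const _).mul_const _

theorem coeffDecay_oneSubPow_neg_one (p : ℝ) : CoeffDecay (oneSubPow (-1)) p := by
  refine .of_isBigO (IsBigO.of_bound 1 ?_)
  filter_upwards [eventually_ge_atTop 2] with n hn
  have h0 : n ≠ 0 := by omega
  have h1 : n ≠ 1 := by omega
  simp only [oneSubPow_neg_one, map_sub, coeff_one, coeff_X, h0, h1, if_false, sub_zero, norm_zero,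
    one_mul]
  positivity

/-- The error of the two-term expansion of `∑ k ^ ν X ^ k` in powers of `1 - X`. -/
noncomputable def monomialRemainder (ν : ℝ) : PowerSeries ℝ :=
  PowerSeries.mk (fun k => (k : ℝ) ^ ν) -
    Real.Gamma (ν + 1) • (oneSubPow (ν + 1) - ((ν + 1) / 2) • oneSubPow ν)

theorem coeffDecay_monomialRemainder {ν : ℝ} (hν : 0 ≤ ν) :
    CoeffDecay (monomialRemainder ν) (ν - 2) := by
  refine .of_isBigO (((rpow_sub_coeff_isBigO hν).trans
    (isTheta_natCast_add_one_rpow _).1).congr_left fun n => ?_)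
  simp [monomialRemainder]

theorem monomialRemainder_one : monomialRemainder 1 = 0 := by
  ext n
  have h1 : ∀ n, coeff n (oneSubPow 1) = 1 := fun n => by
    rw [coeff_oneSubPow_eq_gamma one_pos, add_comm, Real.Gamma_nat_eq_factorial, Real.Gamma_one,
      one_mul, div_self (by positivity)]
  have h2 := coeff_oneSubPow_add_one 1 n
  rw [h1, one_mul, mul_one] at h2
  have h3 : Real.Gamma (1 + 1) = 1 := by norm_num [Real.Gamma_two]
  simp only [monomialRemainder, h3, map_sub, map_smul, coeff_mk, h1, Real.rpow_one, smul_eq_mul,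
    map_zero, h2]
  ring

theorem mk_omegaCoef {β : ℝ} (hβ : 0 < β) :
    PowerSeries.mk (omegaCoef β) =
      ((2 : ℝ) ^ (-β) • PowerSeries.binomialSeries ℝ β) * oneSubPow β := by
  ext n
  rw [smul_mul_assoc, map_smul, coeff_mk, coeff_mul, omegaCoef, smul_eq_mul,
    Finset.Nat.sum_antidiagonal_eq_sum_range_succ
      (fun i j => coeff i (PowerSeries.binomialSeries ℝ β) * coeff j (oneSubPow β)) n]
  congr 1
  refine Finset.sum_congr rfl fun i _ => ?_
  rw [coeff_oneSubPow_eq_gamma hβ, PowerSeries.binomialSeries_coeff, smul_eq_mul, mul_one,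
    choose_eq_genBinom, mul_div_assoc]

theorem coeffDecay_mk_omegaCoef {β : ℝ} (hβ0 : 0 < β) (hβ1 : β < 1) :
    CoeffDecay (PowerSeries.mk (omegaCoef β)) (β - 1) := by
  rw [mk_omegaCoef hβ0]
  have h : CoeffDecay (PowerSeries.binomialSeries ℝ β) (-β - 1) := by
    obtain ⟨C, hC, h⟩ := coeffDecay_oneSubPow (α := -β) (by linarith)
    refine ⟨C, hC, fun n => ?_⟩
    simpa [coeff_oneSubPow_eq_choose, abs_mul] using h n
  exact (h.smul _).mul_of_summable (coeffDecay_oneSubPow_of_pos hβ0) (by linarith) (by linarith)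

theorem quadrature_error_eq {β ν : ℝ} (hβ0 : 0 < β) (hν : 0 ≤ ν) :
    (Real.Gamma (ν + 1) / Real.Gamma (ν + 1 + β)) • PowerSeries.mk (fun k => (k : ℝ) ^ (ν + β)) -
        PowerSeries.mk (fun k => (k : ℝ) ^ ν) * PowerSeries.mk (omegaCoef β) =
      (Real.Gamma (ν + 1) / Real.Gamma (ν + 1 + β)) • monomialRemainder (ν + β) -
        Real.Gamma (ν + 1) • (((ν + 1) * β / 4) • oneSubPow (ν + β - 1) +
          taylorRemainder β * oneSubPow (ν + β - 1) -
          ((ν + 1) / 2) • (oneSubPow (-1) * (taylorRemainder β * oneSubPow (ν + β - 1)))) -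
        monomialRemainder ν * PowerSeries.mk (omegaCoef β) := by
  have hΓ : Real.Gamma (ν + 1 + β) ≠ 0 := (Real.Gamma_pos_of_pos (by linarith)).ne'
  have hc : Real.Gamma (ν + 1) / Real.Gamma (ν + 1 + β) * Real.Gamma (ν + β + 1) =
      Real.Gamma (ν + 1) := by
    rw [add_right_comm ν β 1, div_mul_cancel₀ _ hΓ]
  have hW := mk_omegaCoef hβ0
  rw [smul_binomialSeries_eq] at hW
  have hG : PowerSeries.mk (fun k => (k : ℝ) ^ ν) = monomialRemainder ν +
      Real.Gamma (ν + 1) • (oneSubPow (ν + 1) - ((ν + 1) / 2) • oneSubPow ν) := by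
    rw [monomialRemainder, sub_add_cancel]
  have hmain : (oneSubPow (ν + 1) - ((ν + 1) / 2) • oneSubPow ν) * PowerSeries.mk (omegaCoef β) =
      oneSubPow (ν + β + 1) - ((ν + β + 1) / 2) • oneSubPow (ν + β) +
        (((ν + 1) * β / 4) • oneSubPow (ν + β - 1) +
          taylorRemainder β * oneSubPow (ν + β - 1) -
          ((ν + 1) / 2) • (oneSubPow (-1) * (taylorRemainder β * oneSubPow (ν + β - 1)))) := by
    have a1 : oneSubPow (ν + β + 1) = oneSubPow (ν + 1) * oneSubPow β := by
      rw [← oneSubPow_add]; ring_nf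
    have a2 : oneSubPow (ν + β) = oneSubPow (ν + 1) * oneSubPow β * oneSubPow (-1) := by
      rw [← oneSubPow_add, ← oneSubPow_add]; ring_nf
    have a3 : oneSubPow (ν + β - 1) =
        oneSubPow (ν + 1) * oneSubPow β * oneSubPow (-1) * oneSubPow (-1) := by
      rw [← oneSubPow_add, ← oneSubPow_add, ← oneSubPow_add]; ring_nf
    have a4 : oneSubPow ν = oneSubPow (ν + 1) * oneSubPow (-1) := by
      rw [← oneSubPow_add]; ring_nf
    have a5 : oneSubPow (-2) = oneSubPow (-1) * oneSubPow (-1) := by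
      rw [← oneSubPow_add]; norm_num
    rw [hW, a1, a2, a3, a4, a5]
    simp only [smul_eq_C_mul]
    have c1 : C ((ν + 1) / 2) = C ν * C (1 / 2 : ℝ) + C (1 / 2 : ℝ) := by
      rw [← map_mul, ← map_add]; ring_nf
    have c2 : C ((ν + β + 1) / 2) = C ν * C (1 / 2 : ℝ) + C β * C (1 / 2 : ℝ) + C (1 / 2 : ℝ) := by
      rw [← map_mul, ← map_mul, ← map_add, ← map_add]; ring_nf
    have c3 : C (β / 2) = C β * C (1 / 2 : ℝ) := by
      rw [← map_mul]; ring_nf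
    have c4 : C ((ν + 1) * β / 4) = (C ν + 1) * C β * C (1 / 2 : ℝ) * C (1 / 2 : ℝ) := by
      rw [← map_one C, ← map_add, ← map_mul, ← map_mul, ← map_mul]; ring_nf
    rw [c1, c2, c3, c4]
    ring
  have hE : (Real.Gamma (ν + 1) / Real.Gamma (ν + 1 + β)) • monomialRemainder (ν + β) =
      (Real.Gamma (ν + 1) / Real.Gamma (ν + 1 + β)) • PowerSeries.mk (fun k => (k : ℝ) ^ (ν + β)) -
        Real.Gamma (ν + 1) •
          (oneSubPow (ν + β + 1) - ((ν + β + 1) / 2) • oneSubPow (ν + β)) := by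
    rw [monomialRemainder, smul_sub _ (PowerSeries.mk _), smul_smul, hc]
  rw [hG, add_mul, smul_mul_assoc, hmain, hE]
  module

theorem coeffDecay_monomialRemainder_mul_omegaCoef {β ν : ℝ} (hβ0 : 0 < β) (hβ1 : β < 1)
    (hν : 0 ≤ ν) : CoeffDecay (monomialRemainder ν * PowerSeries.mk (omegaCoef β))
      (max (ν + β - 2) (β - 1)) := by
  have hE := coeffDecay_monomialRemainder hν
  have hW := coeffDecay_mk_omegaCoef hβ0 hβ1
  rcases lt_trichotomy ν 1 with h | rfl | h
  · exact (hE.mul_of_summable hW (by linarith) (by linarith)).mono (le_max_right _ _)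
  · rw [monomialRemainder_one, zero_mul]
    exact .zero _
  · exact (hE.mul hW (by linarith) (by linarith)).mono (le_max_of_le_left (by linarith))

theorem coeffDecay_quadrature_error {β ν : ℝ} (hβ0 : 0 < β) (hβ1 : β < 1) (hν : 0 ≤ ν) :
    CoeffDecay ((Real.Gamma (ν + 1) / Real.Gamma (ν + 1 + β)) •
        PowerSeries.mk (fun k => (k : ℝ) ^ (ν + β)) -
      PowerSeries.mk (fun k => (k : ℝ) ^ ν) * PowerSeries.mk (omegaCoef β))
      (max (ν + β - 2) (β - 1)) := by
  rw [quadrature_error_eq hβ0 hν]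
  have hp : -1 < max (ν + β - 2) (β - 1) := lt_max_of_lt_right (by linarith)
  have hE : CoeffDecay (monomialRemainder (ν + β)) (max (ν + β - 2) (β - 1)) :=
    (coeffDecay_monomialRemainder (by linarith)).mono (le_max_left _ _)
  have hP : CoeffDecay (oneSubPow (ν + β - 1)) (max (ν + β - 2) (β - 1)) :=
    (coeffDecay_oneSubPow (by linarith)).mono (le_max_of_le_left (by linarith))
  have hRP := (coeffDecay_taylorRemainder hβ0 hβ1).mul_of_summable hP (by linarith) hp
  have hDRP := (coeffDecay_oneSubPow_neg_one (-2)).mul_of_summable hRP (by norm_num) hp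
  exact ((hE.smul _).sub ((((hP.smul _).add hRP).sub (hDRP.smul _)).smul _)).sub
    (coeffDecay_monomialRemainder_mul_omegaCoef hβ0 hβ1 hν)

theorem CoeffDecay.exists_le_add {F : PowerSeries ℝ} {p q : ℝ} (hF : CoeffDecay F (max p q)) :
    ∃ C, 0 < C ∧ ∀ n : ℕ, 1 ≤ n → |coeff n F| ≤ C * ((n : ℝ) ^ p + (n : ℝ) ^ q) := by
  obtain ⟨D, hD, h⟩ := hF
  set r := max p q with hr
  refine ⟨D * 2 ^ |r| + 1, by positivity, fun n hn => ?_⟩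
  have hn' : (1 : ℝ) ≤ n := by exact_mod_cast hn
  have h1 : (n + 1 : ℝ) ^ r ≤ 2 ^ |r| * (n : ℝ) ^ r := by
    rcases le_total 0 r with h0 | h0
    · rw [abs_of_nonneg h0, ← Real.mul_rpow (by norm_num) (by linarith)]
      exact Real.rpow_le_rpow (by linarith) (by linarith) h0
    · refine (Real.rpow_le_rpow_of_nonpos (by linarith) (by linarith : (n : ℝ) ≤ n + 1) h0).trans ?_
      exact le_mul_of_one_le_left (by positivity) (Real.one_le_rpow (by norm_num) (abs_nonneg r))
  have h2 : (n : ℝ) ^ r ≤ (n : ℝ) ^ p + (n : ℝ) ^ q := by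
    have hp : 0 ≤ (n : ℝ) ^ p := by positivity
    have hq : 0 ≤ (n : ℝ) ^ q := by positivity
    rcases max_choice p q with h0 | h0 <;> rw [hr, h0] <;> linarith
  calc |coeff n F| ≤ D * (2 ^ |r| * (n : ℝ) ^ r) := (h n).trans (by gcongr)
    _ = D * 2 ^ |r| * (n : ℝ) ^ r := by ring
    _ ≤ (D * 2 ^ |r| + 1) * ((n : ℝ) ^ p + (n : ℝ) ^ q) := by
        gcongr
        linarith

/-- Lemma 2.2: quadrature error of the fractional linear multistep method on
monomials `u(t) = t^ν`, for which `(I_0^β u)(t_n) = Γ(ν+1)/Γ(ν+1+β) t_n^{ν+β}`. -/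
theorem flmm_monomial_error (β ν T : ℝ) (hβ0 : 0 < β) (hβ1 : β < 1)
    (hν : 0 ≤ ν) (hT : 0 < T) :
    ∃ C : ℝ, 0 < C ∧ ∀ h : ℝ, 0 < h → ∀ n : ℕ, 1 ≤ n → (n : ℝ) * h ≤ T →
      |Real.Gamma (ν + 1) / Real.Gamma (ν + 1 + β) * ((n : ℝ) * h) ^ (ν + β) -
          h ^ β * ∑ k ∈ Finset.range (n + 1), omegaCoef β (n - k) * ((k : ℝ) * h) ^ ν| ≤
        C * (h ^ 2 * ((n : ℝ) * h) ^ (ν + β - 2) + h ^ (1 + ν) * ((n : ℝ) * h) ^ (β - 1)) := by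
  obtain ⟨C, hC, herr⟩ := (coeffDecay_quadrature_error hβ0 hβ1 hν).exists_le_add
  refine ⟨C, hC, fun h hh n hn _ => ?_⟩
  have hn' : (0 : ℝ) < n := by exact_mod_cast hn
  have hsum : ∑ k ∈ Finset.range (n + 1), omegaCoef β (n - k) * ((k : ℝ) * h) ^ ν =
      h ^ ν * coeff n (PowerSeries.mk (fun k => (k : ℝ) ^ ν) * PowerSeries.mk (omegaCoef β)) := by
    rw [coeff_mul, Finset.Nat.sum_antidiagonal_eq_sum_range_succ
      (fun i j => coeff i (PowerSeries.mk fun k => (k : ℝ) ^ ν) *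
        coeff j (PowerSeries.mk (omegaCoef β))) n, Finset.mul_sum]
    refine Finset.sum_congr rfl fun k _ => ?_
    rw [Real.mul_rpow k.cast_nonneg hh.le, coeff_mk, coeff_mk]
    ring
  have hlhs : Real.Gamma (ν + 1) / Real.Gamma (ν + 1 + β) * ((n : ℝ) * h) ^ (ν + β) -
      h ^ β * ∑ k ∈ Finset.range (n + 1), omegaCoef β (n - k) * ((k : ℝ) * h) ^ ν =
      h ^ (ν + β) * coeff n ((Real.Gamma (ν + 1) / Real.Gamma (ν + 1 + β)) •
        PowerSeries.mk (fun k => (k : ℝ) ^ (ν + β)) -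
      PowerSeries.mk (fun k => (k : ℝ) ^ ν) * PowerSeries.mk (omegaCoef β)) := by
    rw [hsum, map_sub, map_smul, coeff_mk, smul_eq_mul, Real.mul_rpow hn'.le hh.le,
      Real.rpow_add hh]
    ring
  have hrhs : h ^ 2 * ((n : ℝ) * h) ^ (ν + β - 2) + h ^ (1 + ν) * ((n : ℝ) * h) ^ (β - 1) =
      h ^ (ν + β) * ((n : ℝ) ^ (ν + β - 2) + (n : ℝ) ^ (β - 1)) := by
    have h1 : h ^ 2 * h ^ (ν + β - 2) = h ^ (ν + β) := by
      rw [← Real.rpow_natCast h 2, ← Real.rpow_add hh]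
      norm_num
    have h2 : h ^ (1 + ν) * h ^ (β - 1) = h ^ (ν + β) := by
      rw [← Real.rpow_add hh]
      ring_nf
    rw [Real.mul_rpow hn'.le hh.le, Real.mul_rpow hn'.le hh.le]
    linear_combination (n : ℝ) ^ (ν + β - 2) * h1 + (n : ℝ) ^ (β - 1) * h2
  rw [hlhs, hrhs, abs_mul, abs_of_pos (Real.rpow_pos_of_pos hh _), mul_left_comm]
  exact mul_le_mul_of_nonneg_left (herr n hn) (Real.rpow_nonneg hh.le _)
end

section
/- Linear stability of the fractional test equation (Theorem 3.1): Let 0<β<1 and s ∈ ℂ with s ≠ 0. (i) If |arg(s)| > βπ/2, then every continuous function u:[0,∞)→ℂ satisfying u(t) = u(0) + s·(I_0^β u)(t) for all t ≥ 0 (the integral form of ^CD_0^β u = s u) satisfies u(t) → 0 as t → ∞. (ii) Conversely, if |arg(s)| ≤ βπ/2 and u(0) ≠ 0, then such a solution u does not tend to 0 as t → ∞. -/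
/-- Riemann–Liouville fractional integral `(I_0^β g)(t)` of a complex-valued
function, applied componentwise. -/
noncomputable def fracIntC (β : ℝ) (g : ℝ → ℂ) (t : ℝ) : ℂ :=
  (Real.Gamma β : ℂ)⁻¹ * ∫ τ in (0 : ℝ)..t, (((t - τ) ^ (β - 1) : ℝ) : ℂ) * g τ

open MeasureTheory Set Filter Topology

lemma integrableOn_rpow_mul_cexp {β : ℝ} (hβ : -1 < β) {z : ℂ} (hz : 0 < z.re) :
    IntegrableOn (fun t : ℝ => ((t ^ β : ℝ) : ℂ) * Complex.exp (-z * t)) (Ioi 0) := by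
  have h := integrableOn_rpow_mul_exp_neg_mul_rpow (p := 1) hβ one_pos hz
  refine Integrable.mono' h ?_ ?_
  · exact (Measurable.aestronglyMeasurable (by fun_prop))
  · filter_upwards [ae_restrict_mem measurableSet_Ioi] with t ht
    rw [norm_mul, Complex.norm_exp, Complex.norm_real, Real.norm_of_nonneg (Real.rpow_nonneg ht.le _)]
    simp

lemma differentiableAt_integral_rpow_mul_cexp {β : ℝ} (hβ : 0 < β) {z : ℂ} (hz : 0 < z.re) :
    DifferentiableAt ℂ
      (fun z : ℂ => ∫ t : ℝ in Ioi 0, ((t ^ (β - 1) : ℝ) : ℂ) * Complex.exp (-z * t)) z := by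
  have hb : IntegrableOn (fun t : ℝ => t ^ β * Real.exp (-(z.re / 2) * t ^ (1 : ℝ))) (Ioi 0) :=
    integrableOn_rpow_mul_exp_neg_mul_rpow (by linarith) one_pos (by linarith)
  refine (hasDerivAt_integral_of_dominated_loc_of_deriv_le (𝕜 := ℂ) (μ := volume.restrict (Ioi 0))
    (F := fun (w : ℂ) (t : ℝ) => ((t ^ (β - 1) : ℝ) : ℂ) * Complex.exp (-w * t))
    (F' := fun (w : ℂ) (t : ℝ) => ((t ^ (β - 1) : ℝ) : ℂ) * (Complex.exp (-w * t) * (-1 * t)))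
    (Metric.ball_mem_nhds z (half_pos hz)) ?_
    (integrableOn_rpow_mul_cexp (by linarith) hz) ?_ ?_ hb ?_).2.differentiableAt
  · exact Eventually.of_forall fun w => Measurable.aestronglyMeasurable (by fun_prop)
  · exact Measurable.aestronglyMeasurable (by fun_prop)
  · filter_upwards [ae_restrict_mem measurableSet_Ioi] with t ht w hw
    have ht' : (0 : ℝ) < t := ht
    have hre : z.re / 2 < w.re := by
      have h1 := (Complex.abs_re_le_norm (w - z)).trans_lt (by simpa [dist_eq_norm] using hw)
      rw [Complex.sub_re] at h1
      linarith [(abs_lt.1 h1).1]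
    have hE : ‖Complex.exp (-w * t)‖ ≤ Real.exp (-(z.re / 2) * t) := by
      rw [Complex.norm_exp]
      apply Real.exp_le_exp.2
      simp only [neg_mul, Complex.neg_re, Complex.mul_re, Complex.ofReal_re, Complex.ofReal_im,
        mul_zero, sub_zero]
      nlinarith
    have h2 : t ^ β = t ^ (β - 1) * t := by
      rw [← Real.rpow_add_one ht'.ne']; simp
    rw [norm_mul, norm_mul, Complex.norm_real, Real.norm_of_nonneg (Real.rpow_nonneg ht'.le _),
      norm_mul, norm_neg, norm_one, one_mul, Complex.norm_real, Real.norm_of_nonneg ht'.le,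
      Real.rpow_one, h2]
    have := Real.rpow_nonneg ht'.le (β - 1)
    calc _ ≤ t ^ (β - 1) * (Real.exp (-(z.re / 2) * t) * t) := by gcongr
      _ = _ := by ring
  · refine Eventually.of_forall fun t w _ => ?_
    have h : HasDerivAt (fun w : ℂ => -w * t) (-1 * t) w := (hasDerivAt_neg w).mul_const _
    exact h.cexp.const_mul _

lemma mem_slitPlane_of_re_pos {z : ℂ} (hz : 0 < z.re) : z ∈ Complex.slitPlane :=
  Or.inl hz

/-- The Laplace transform of `t ^ (β - 1)` on the right half-plane. -/
lemma integral_rpow_mul_cexp {β : ℝ} (hβ : 0 < β) {z : ℂ} (hz : 0 < z.re) :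
    ∫ t : ℝ in Ioi 0, ((t ^ (β - 1) : ℝ) : ℂ) * Complex.exp (-z * t) =
      Real.Gamma β * z ^ (-(β : ℂ)) := by
  have hopen : IsOpen {z : ℂ | 0 < z.re} := isOpen_lt continuous_const Complex.continuous_re
  have hf : AnalyticOnNhd ℂ (fun z : ℂ =>
      ∫ t : ℝ in Ioi 0, ((t ^ (β - 1) : ℝ) : ℂ) * Complex.exp (-z * t)) {z : ℂ | 0 < z.re} :=
    DifferentiableOn.analyticOnNhd (fun w hw =>
      (differentiableAt_integral_rpow_mul_cexp hβ hw).differentiableWithinAt) hopen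
  have hg : AnalyticOnNhd ℂ (fun z : ℂ => (Real.Gamma β : ℂ) * z ^ (-(β : ℂ)))
      {z : ℂ | 0 < z.re} :=
    DifferentiableOn.analyticOnNhd (fun w hw => (DifferentiableAt.const_mul
      (differentiableAt_id.cpow_const (mem_slitPlane_of_re_pos hw)) _).differentiableWithinAt)
      hopen
  have hconn : IsPreconnected {z : ℂ | 0 < z.re} := (convex_halfSpace_re_gt 0).isPreconnected
  refine hf.eqOn_of_preconnected_of_frequently_eq hg hconn (z₀ := 1) (by simp) ?_ hz
  have hreal : ∀ x : ℝ, 0 < x →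
      ∫ t : ℝ in Ioi 0, ((t ^ (β - 1) : ℝ) : ℂ) * Complex.exp (-(x : ℂ) * t) =
      Real.Gamma β * (x : ℂ) ^ (-(β : ℂ)) := by
    intro x hx
    have h := Real.integral_rpow_mul_exp_neg_mul_Ioi hβ hx
    have h2 : ∫ t : ℝ in Ioi 0, ((t ^ (β - 1) : ℝ) : ℂ) * Complex.exp (-(x : ℂ) * t) =
        ((∫ t : ℝ in Ioi 0, t ^ (β - 1) * Real.exp (-(x * t)) : ℝ) : ℂ) := by
      rw [← integral_complex_ofReal]
      congr 1 with t
      push_cast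
      simp
    rw [h2, h, one_div, Real.inv_rpow hx.le, ← Real.rpow_neg hx.le, Complex.ofReal_mul,
      Complex.ofReal_cpow hx.le]
    push_cast
    ring
  have htend : Tendsto (fun n : ℕ => (((1 + 1 / ((n : ℝ) + 1) : ℝ)) : ℂ)) atTop (𝓝[≠] 1) := by
    rw [tendsto_nhdsWithin_iff]
    constructor
    · have := (tendsto_one_div_add_atTop_nhds_zero_nat (𝕜 := ℝ)).const_add 1
      rw [add_zero] at this
      exact_mod_cast (Complex.continuous_ofReal.tendsto 1).comp this
    · refine Eventually.of_forall fun n => ?_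
      have : (0 : ℝ) < 1 / ((n : ℝ) + 1) := by positivity
      simp only [mem_compl_iff, mem_singleton_iff]
      exact_mod_cast (lt_add_of_pos_right (1 : ℝ) this).ne'
  exact htend.frequently (Eventually.of_forall fun n => hreal _ (by positivity)).frequently

/-- The Laplace transform of the integral form of the fractional test equation. -/
lemma laplace_fractional_test_equation {β : ℝ} (hβ : 0 < β) {s : ℂ} {u : ℝ → ℂ}
    (hsol : ∀ t : ℝ, 0 ≤ t → u t = u 0 + s * fracIntC β u t) {z : ℂ} (hz : 0 < z.re)
    (hui : IntegrableOn (fun t : ℝ => Complex.exp (-z * t) * u t) (Ioi 0)) :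
    (z ^ (β : ℂ) - s) * ∫ t : ℝ in Ioi 0, Complex.exp (-z * t) * u t = u 0 * (z ^ (β : ℂ) / z) := by
  have hz0 : z ≠ 0 := by rintro rfl; simp at hz
  have hΓ : (Real.Gamma β : ℂ) ≠ 0 := by exact_mod_cast (Real.Gamma_pos_of_pos hβ).ne'
  have hk := integrableOn_rpow_mul_cexp (β := β - 1) (by linarith) hz
  have hexp : IntegrableOn (fun t : ℝ => Complex.exp (-z * t)) (Ioi 0) :=
    integrableOn_exp_mul_complex_Ioi (by simpa using hz) 0
  have hexpint : ∫ t : ℝ in Ioi 0, Complex.exp (-z * t) = 1 / z := by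
    rw [integral_exp_mul_complex_Ioi (by simpa using hz) 0]
    simp
  set L := ContinuousLinearMap.mul ℝ ℂ
  have hconv := integral_posConvolution hui hk L
  have hconvi := integrable_posConvolution hui hk L
  have hpt : ∀ t : ℝ, 0 < t → ∫ τ in (0 : ℝ)..t, L (Complex.exp (-z * τ) * u τ)
      ((((t - τ) ^ (β - 1) : ℝ) : ℂ) * Complex.exp (-z * (t - τ : ℝ))) =
      Real.Gamma β * (Complex.exp (-z * t) * fracIntC β u t) := by
    intro t ht
    have : ∀ τ : ℝ, L (Complex.exp (-z * τ) * u τ)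
        ((((t - τ) ^ (β - 1) : ℝ) : ℂ) * Complex.exp (-z * (t - τ : ℝ))) =
        Complex.exp (-z * t) * ((((t - τ) ^ (β - 1) : ℝ) : ℂ) * u τ) := by
      intro τ
      have h3 : Complex.exp (-z * t) = Complex.exp (-z * τ) * Complex.exp (-z * (t - τ : ℝ)) := by
        rw [← Complex.exp_add]; congr 1; push_cast; ring
      rw [h3]
      simp only [L, ContinuousLinearMap.mul_apply']
      ring
    simp_rw [this]
    rw [intervalIntegral.integral_const_mul, fracIntC]
    field_simp
  have hpt2 : ∀ t ∈ Ioi (0 : ℝ), Complex.exp (-z * t) * u t =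
      u 0 * Complex.exp (-z * t) + s * (Real.Gamma β : ℂ)⁻¹ *
      ∫ τ in (0 : ℝ)..t, L (Complex.exp (-z * τ) * u τ)
      ((((t - τ) ^ (β - 1) : ℝ) : ℂ) * Complex.exp (-z * (t - τ : ℝ))) := by
    intro t ht
    rw [hpt t ht]
    nth_rw 1 [hsol t (le_of_lt ht)]
    field_simp
  have hci : IntegrableOn (fun t : ℝ => ∫ τ in (0 : ℝ)..t, L (Complex.exp (-z * τ) * u τ)
      ((((t - τ) ^ (β - 1) : ℝ) : ℂ) * Complex.exp (-z * (t - τ : ℝ)))) (Ioi 0) := by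
    rw [← integrable_indicator_iff measurableSet_Ioi]
    exact hconvi
  have key := setIntegral_congr_fun (μ := volume) measurableSet_Ioi hpt2
  rw [integral_add (hexp.const_mul _) (hci.const_mul _), integral_const_mul, integral_const_mul,
    hconv, hexpint, integral_rpow_mul_cexp hβ hz] at key
  set U := ∫ t : ℝ in Ioi 0, Complex.exp (-z * t) * u t
  simp only [L, ContinuousLinearMap.mul_apply'] at key
  have hzb : z ^ (β : ℂ) ≠ 0 := by simp [Complex.cpow_eq_zero_iff, hz0]
  rw [Complex.cpow_neg] at key
  field_simp at key ⊢
  linear_combination key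

lemma norm_cexp_neg_mul_ofReal (z : ℂ) (t : ℝ) :
    ‖Complex.exp (-z * t)‖ = Real.exp (-(z.re * t)) := by
  rw [Complex.norm_exp]; simp

lemma integrableOn_cexp_mul_of_le_exp {u : ℝ → ℂ} (hu : ContinuousOn u (Ici 0)) {M a : ℝ}
    (hM : ∀ t : ℝ, 0 ≤ t → ‖u t‖ ≤ M * Real.exp (a * t)) {z : ℂ} (hz : a < z.re) :
    IntegrableOn (fun t : ℝ => Complex.exp (-z * t) * u t) (Ioi 0) := by
  have h := (integrableOn_exp_mul_Ioi (a := a - z.re) (by linarith) 0).const_mul M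
  refine Integrable.mono' h ?_ ?_
  · refine AEStronglyMeasurable.mul (Measurable.aestronglyMeasurable (by fun_prop)) ?_
    exact (hu.mono Ioi_subset_Ici_self).aestronglyMeasurable measurableSet_Ioi
  · filter_upwards [ae_restrict_mem measurableSet_Ioi] with t ht
    rw [norm_mul, norm_cexp_neg_mul_ofReal]
    calc _ ≤ Real.exp (-(z.re * t)) * (M * Real.exp (a * t)) := by
          gcongr; exact hM t (le_of_lt ht)
      _ = M * (Real.exp (a * t) * Real.exp (-(z.re * t))) := by ring
      _ = _ := by rw [← Real.exp_add]; congr 2; ring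

lemma exists_norm_le_of_tendsto_zero {u : ℝ → ℂ} (hu : ContinuousOn u (Ici 0))
    (h0 : Tendsto u atTop (𝓝 0)) : ∃ M, 0 ≤ M ∧ ∀ t : ℝ, 0 ≤ t → ‖u t‖ ≤ M := by
  have h1 : ∀ᶠ t in atTop, ‖u t‖ < 1 := by
    have := h0.norm
    rw [norm_zero] at this
    exact this.eventually_lt_const one_pos
  obtain ⟨T, hT⟩ := eventually_atTop.1 h1
  obtain ⟨C, hC⟩ := isCompact_Icc.exists_bound_of_continuousOn
    (hu.mono (Icc_subset_Ici_self : Icc 0 T ⊆ Ici 0))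
  refine ⟨max C 1, le_max_of_le_right zero_le_one, fun t ht => ?_⟩
  rcases le_total t T with h | h
  · exact (hC t ⟨ht, h⟩).trans (le_max_left _ _)
  · exact (hT t h).le.trans (le_max_right _ _)

/-- Abelian theorem: if `u` vanishes at infinity and `0 ≤ z.re`, then the Laplace transform of `u`
at `z + ε` is `o(1 / ε)` as `ε` tends to zero from the right. -/
lemma tendsto_mul_laplace_zero {u : ℝ → ℂ} (hu : ContinuousOn u (Ici 0))
    (h0 : Tendsto u atTop (𝓝 0)) {z : ℂ} (hz : 0 ≤ z.re) :
    Tendsto (fun ε : ℝ => (ε : ℂ) * ∫ t : ℝ in Ioi 0, Complex.exp (-(z + ε) * t) * u t)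
      (𝓝[>] 0) (𝓝 0) := by
  obtain ⟨M, hM0, hM⟩ := exists_norm_le_of_tendsto_zero hu h0
  have hlim : Tendsto (fun ε : ℝ => ∫ r : ℝ in Ioi 0, Real.exp (-r) * ‖u (r / ε)‖)
      (𝓝[>] 0) (𝓝 (∫ r : ℝ in Ioi 0, (0 : ℝ))) := by
    refine tendsto_integral_filter_of_dominated_convergence (fun r => M * Real.exp (-r)) ?_ ?_
      ((integrableOn_exp_neg_Ioi 0).const_mul M) ?_
    · filter_upwards [self_mem_nhdsWithin] with ε hε
      refine AEStronglyMeasurable.mul (Measurable.aestronglyMeasurable (by fun_prop)) ?_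
      refine (ContinuousOn.aestronglyMeasurable ?_ measurableSet_Ioi).norm
      refine hu.comp (by fun_prop) fun r hr => ?_
      exact div_nonneg (le_of_lt hr) (le_of_lt (mem_Ioi.1 hε))
    · filter_upwards [self_mem_nhdsWithin] with ε hε
      filter_upwards [ae_restrict_mem measurableSet_Ioi] with r hr
      rw [norm_mul, norm_norm, Real.norm_of_nonneg (Real.exp_pos _).le, mul_comm]
      gcongr
      exact hM _ (div_nonneg (le_of_lt hr) (le_of_lt hε))
    · filter_upwards [ae_restrict_mem measurableSet_Ioi] with r hr
      have h1 : Tendsto (fun ε : ℝ => r / ε) (𝓝[>] 0) atTop := by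
        simp_rw [div_eq_mul_inv]
        exact tendsto_inv_nhdsGT_zero.const_mul_atTop hr
      have h2 := ((h0.comp h1).norm).const_mul (Real.exp (-r))
      simpa using h2
  rw [integral_zero] at hlim
  refine squeeze_zero_norm' ?_ hlim
  filter_upwards [self_mem_nhdsWithin] with ε hε
  have hε' : (0 : ℝ) < ε := hε
  have hsub := integral_comp_mul_left_Ioi (fun r : ℝ => Real.exp (-r) * ‖u (r / ε)‖) 0 hε'
  rw [mul_zero, smul_eq_mul] at hsub
  have hI : ∫ r : ℝ in Ioi 0, Real.exp (-r) * ‖u (r / ε)‖ =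
      ε * ∫ t : ℝ in Ioi 0, Real.exp (-(ε * t)) * ‖u t‖ := by
    have h3 : ∀ t : ℝ, ε * t / ε = t := fun t => by field_simp
    simp_rw [h3] at hsub
    rw [hsub]; field_simp
  rw [hI, norm_mul, Complex.norm_real, Real.norm_of_nonneg hε'.le]
  gcongr
  have hi : IntegrableOn (fun t : ℝ => Real.exp (-(ε * t)) * ‖u t‖) (Ioi 0) := by
    have := (integrableOn_cexp_mul_of_le_exp hu (M := M) (a := 0) (by simpa using hM)
      (z := (ε : ℂ)) (by simpa using hε')).norm
    simp_rw [norm_mul, norm_cexp_neg_mul_ofReal] at this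
    simpa [IntegrableOn] using this
  refine norm_integral_le_of_norm_le hi ?_
  filter_upwards [ae_restrict_mem measurableSet_Ioi] with t ht
  have ht' : (0 : ℝ) < t := ht
  rw [norm_mul, norm_cexp_neg_mul_ofReal]
  gcongr
  simp [hz]

/-- In the unstable sector `|arg s| ≤ βπ/2`, the principal root `s ^ (1 / β)` lies in the closed
right half-plane. -/
lemma exists_cpow_eq_of_abs_arg_le {β : ℝ} (hβ : 0 < β) {s : ℂ} (hs : s ≠ 0)
    (harg : |Complex.arg s| ≤ β * Real.pi / 2) :
    ∃ z : ℂ, 0 ≤ z.re ∧ z ≠ 0 ∧ z ∈ Complex.slitPlane ∧ z ^ (β : ℂ) = s := by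
  have hβc : (β : ℂ) ≠ 0 := by exact_mod_cast hβ.ne'
  have him : (Complex.log s * ((β⁻¹ : ℝ) : ℂ)).im = Complex.arg s * β⁻¹ := by
    rw [Complex.im_mul_ofReal, Complex.log_im]
  have hle : |Complex.arg s * β⁻¹| ≤ Real.pi / 2 := by
    rw [abs_mul, abs_of_pos (inv_pos.2 hβ), ← div_eq_mul_inv, div_le_iff₀ hβ]
    linarith
  have hb := abs_le.1 hle
  have hpi := Real.pi_pos
  have hlog : Complex.log (s ^ ((β⁻¹ : ℝ) : ℂ)) = Complex.log s * ((β⁻¹ : ℝ) : ℂ) := by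
    rw [Complex.cpow_def_of_ne_zero hs, Complex.log_exp]
    · rw [him]; linarith
    · rw [him]; linarith
  have hne : s ^ ((β⁻¹ : ℝ) : ℂ) ≠ 0 := by simp [Complex.cpow_eq_zero_iff, hs]
  have harg2 : Complex.arg (s ^ ((β⁻¹ : ℝ) : ℂ)) = Complex.arg s * β⁻¹ := by
    rw [← Complex.log_im, hlog, him]
  refine ⟨s ^ ((β⁻¹ : ℝ) : ℂ), ?_, hne, ?_, ?_⟩
  · rw [← Complex.abs_arg_le_pi_div_two_iff, harg2]; exact hle
  · rw [Complex.mem_slitPlane_iff_arg]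
    refine ⟨?_, hne⟩
    rw [harg2]
    linarith
  · rw [Complex.cpow_def_of_ne_zero hne, hlog, mul_assoc]
    push_cast
    rw [inv_mul_cancel₀ hβc, mul_one, Complex.exp_log hs]

lemma not_tendsto_zero_of_abs_arg_le {β : ℝ} (hβ : 0 < β) {s : ℂ} (hs : s ≠ 0)
    {u : ℝ → ℂ} (hu : ContinuousOn u (Ici 0))
    (hsol : ∀ t : ℝ, 0 ≤ t → u t = u 0 + s * fracIntC β u t)
    (harg : |Complex.arg s| ≤ β * Real.pi / 2) (hu0 : u 0 ≠ 0) :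
    ¬ Tendsto u atTop (𝓝 0) := by
  intro h0
  obtain ⟨z, hz, hz0, hzs, hpow⟩ := exists_cpow_eq_of_abs_arg_le hβ hs harg
  obtain ⟨M, hM0, hM⟩ := exists_norm_le_of_tendsto_zero hu h0
  have hlim := tendsto_mul_laplace_zero hu h0 hz
  have hd : HasDerivAt (fun w : ℂ => w ^ (β : ℂ)) ((β : ℂ) * z ^ ((β : ℂ) - 1) * 1) z :=
    (hasDerivAt_id z).cpow_const hzs
  have hto : Tendsto (fun ε : ℝ => (ε : ℂ)) (𝓝[>] 0) (𝓝[≠] 0) := by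
    rw [tendsto_nhdsWithin_iff]
    refine ⟨(Complex.continuous_ofReal.tendsto' 0 0 (by simp)).mono_left nhdsWithin_le_nhds, ?_⟩
    filter_upwards [self_mem_nhdsWithin] with ε hε
    simpa using (ne_of_gt hε)
  have hquot := (hasDerivAt_iff_tendsto_slope_zero.1 hd).comp hto
  have hprod := hquot.mul hlim
  rw [mul_zero] at hprod
  have hcont : Tendsto (fun ε : ℝ => u 0 * ((z + ε) ^ (β : ℂ) / (z + ε))) (𝓝[>] 0)
      (𝓝 (u 0 * (z ^ (β : ℂ) / z))) := by
    have h1 : Tendsto (fun ε : ℝ => z + (ε : ℂ)) (𝓝[>] 0) (𝓝 z) := by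
      simpa using (hto.mono_right nhdsWithin_le_nhds).const_add z
    exact ((hd.continuousAt.tendsto.comp h1).div h1 hz0).const_mul _
  have heq : (fun ε : ℝ => u 0 * ((z + ε) ^ (β : ℂ) / (z + ε))) =ᶠ[𝓝[>] 0] fun ε =>
      ((fun t : ℂ => t⁻¹ • ((z + t) ^ (β : ℂ) - z ^ (β : ℂ))) ∘ fun ε : ℝ => (ε : ℂ)) ε *
      ((ε : ℂ) * ∫ t : ℝ in Ioi 0, Complex.exp (-(z + ε) * t) * u t) := by
    filter_upwards [self_mem_nhdsWithin] with ε hε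
    have hε' : (0 : ℝ) < ε := hε
    have hre : 0 < (z + ε).re := by simp; linarith
    rw [← laplace_fractional_test_equation hβ hsol hre
      (integrableOn_cexp_mul_of_le_exp hu (M := M) (a := 0) (by simpa using hM) hre)]
    have : (ε : ℂ) ≠ 0 := by exact_mod_cast hε'.ne'
    simp only [Function.comp, smul_eq_mul, hpow]
    field_simp
  have := tendsto_nhds_unique (hcont.congr' heq) hprod
  rw [hpow] at this
  simp [hu0, hs, hz0] at this

lemma integral_rpow_mul_exp_sub_le {β a t : ℝ} (hβ : 0 < β) (ha : 0 < a) (ht : 0 ≤ t) :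
    ∫ τ in (0 : ℝ)..t, (t - τ) ^ (β - 1) * Real.exp (-(a * (t - τ))) ≤
      a ^ (-β) * Real.Gamma β := by
  have h := intervalIntegral.integral_comp_sub_left (a := 0) (b := t)
    (fun r : ℝ => r ^ (β - 1) * Real.exp (-(a * r))) t
  rw [h, sub_self, sub_zero, intervalIntegral.integral_of_le ht]
  have hG := Real.integral_rpow_mul_exp_neg_mul_Ioi hβ ha
  rw [one_div, Real.inv_rpow ha.le, ← Real.rpow_neg ha.le] at hG
  rw [← hG]
  refine setIntegral_mono_set ?_ ?_ (Ioc_subset_Ioi_self.eventuallyLE)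
  · have := integrableOn_rpow_mul_exp_neg_mul_rpow (s := β - 1) (p := 1) (by linarith) one_pos ha
    simpa using this
  · filter_upwards [ae_restrict_mem measurableSet_Ioi] with r hr
    exact mul_nonneg (Real.rpow_nonneg (le_of_lt hr) _) (Real.exp_pos _).le

lemma exists_norm_le_mul_exp {β : ℝ} (hβ : 0 < β) {s : ℂ} {u : ℝ → ℂ}
    (hu : ContinuousOn u (Ici 0))
    (hsol : ∀ t : ℝ, 0 ≤ t → u t = u 0 + s * fracIntC β u t) :
    ∃ M a : ℝ, 0 < a ∧ ∀ t : ℝ, 0 ≤ t → ‖u t‖ ≤ M * Real.exp (a * t) := by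
  obtain ⟨a, ha1, ha⟩ : ∃ a : ℝ, ‖s‖ * a ^ (-β) < 1 / 2 ∧ 0 < a := by
    have h := (tendsto_rpow_neg_atTop hβ).const_mul ‖s‖
    rw [mul_zero] at h
    exact ((h.eventually_lt_const one_half_pos).and (eventually_gt_atTop 0)).exists
  refine ⟨2 * ‖u 0‖, a, ha, fun T hT => ?_⟩
  have hΓ := Real.Gamma_pos_of_pos hβ
  have hφ : ContinuousOn (fun t : ℝ => ‖u t‖ * Real.exp (-(a * t))) (Icc 0 T) :=
    ((hu.mono Icc_subset_Ici_self).norm).mul (by fun_prop)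
  obtain ⟨t, ht, hmax⟩ := isCompact_Icc.exists_isMaxOn (nonempty_Icc.2 hT) hφ
  set m := ‖u t‖ * Real.exp (-(a * t)) with hm
  have hm0 : 0 ≤ m := by positivity
  have hle : ∀ τ ∈ Icc 0 T, ‖u τ‖ ≤ m * Real.exp (a * τ) := by
    intro τ hτ
    have h1 : ‖u τ‖ * Real.exp (-(a * τ)) ≤ m := hmax hτ
    rwa [Real.exp_neg, ← div_eq_mul_inv, div_le_iff₀ (Real.exp_pos _)] at h1
  have hfrac : ‖fracIntC β u t‖ ≤ m * Real.exp (a * t) * a ^ (-β) := by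
    have hi : IntervalIntegrable (fun τ => m * Real.exp (a * t) *
        ((t - τ) ^ (β - 1) * Real.exp (-(a * (t - τ))))) volume 0 t := by
      refine IntervalIntegrable.const_mul (IntervalIntegrable.mul_continuousOn ?_
        (by fun_prop)) _
      have := (intervalIntegral.intervalIntegrable_rpow' (r := β - 1) (a := t) (b := 0)
        (by linarith)).comp_sub_left t
      simpa using this
    have h2 : ‖∫ τ in (0 : ℝ)..t, (((t - τ) ^ (β - 1) : ℝ) : ℂ) * u τ‖ ≤
        ∫ τ in (0 : ℝ)..t, m * Real.exp (a * t) *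
          ((t - τ) ^ (β - 1) * Real.exp (-(a * (t - τ)))) := by
      refine intervalIntegral.norm_integral_le_of_norm_le ht.1 ?_ hi
      refine Eventually.of_forall fun τ hτ => ?_
      have h3 : 0 ≤ (t - τ) ^ (β - 1) := Real.rpow_nonneg (by linarith [hτ.2]) _
      rw [norm_mul, Complex.norm_real, Real.norm_of_nonneg h3]
      calc _ ≤ (t - τ) ^ (β - 1) * (m * Real.exp (a * τ)) := by
            gcongr; exact hle τ ⟨hτ.1.le, hτ.2.trans ht.2⟩
        _ = (t - τ) ^ (β - 1) * (m * (Real.exp (a * t) * Real.exp (-(a * (t - τ))))) := by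
            rw [← Real.exp_add]; congr 3; ring
        _ = _ := by ring
    rw [fracIntC, norm_mul, norm_inv, Complex.norm_real, Real.norm_of_nonneg hΓ.le]
    rw [intervalIntegral.integral_const_mul] at h2
    have h4 := integral_rpow_mul_exp_sub_le hβ ha ht.1
    calc _ ≤ (Real.Gamma β)⁻¹ * (m * Real.exp (a * t) * (a ^ (-β) * Real.Gamma β)) := by
          gcongr; exact h2.trans (by gcongr)
      _ = _ := by field_simp
  have hut : ‖u t‖ ≤ ‖u 0‖ + ‖s‖ * (m * Real.exp (a * t) * a ^ (-β)) := by
    rw [hsol t ht.1]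
    refine (norm_add_le _ _).trans ?_
    rw [norm_mul]
    gcongr
  have hm2 : m ≤ 2 * ‖u 0‖ := by
    have h5 : m ≤ ‖u 0‖ * Real.exp (-(a * t)) + m * (‖s‖ * a ^ (-β)) := by
      calc m ≤ (‖u 0‖ + ‖s‖ * (m * Real.exp (a * t) * a ^ (-β))) * Real.exp (-(a * t)) := by
            rw [hm]; gcongr
        _ = ‖u 0‖ * Real.exp (-(a * t)) + m * (‖s‖ * a ^ (-β)) *
            (Real.exp (a * t) * Real.exp (-(a * t))) := by ring
        _ = _ := by rw [← Real.exp_add]; simp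
    have h6 : Real.exp (-(a * t)) ≤ 1 := by
      rw [Real.exp_le_one_iff]; nlinarith [ht.1]
    nlinarith [norm_nonneg (u 0), mul_le_mul_of_nonneg_left h6 (norm_nonneg (u 0)),
      mul_le_mul_of_nonneg_left ha1.le hm0]
  calc ‖u T‖ ≤ m * Real.exp (a * T) := hle T ⟨hT, le_rfl⟩
    _ ≤ _ := by gcongr

/-- In the stable sector, `z ^ β` stays away from `s` for `z` in the closed right half-plane. -/
lemma exists_le_norm_cpow_sub {β : ℝ} (hβ : 0 < β) (hβ1 : β < 1) {s : ℂ} (hs : s ≠ 0)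
    (harg : β * Real.pi / 2 < |Complex.arg s|) :
    ∃ c : ℝ, 0 < c ∧ ∀ z : ℂ, 0 ≤ z.re → z ≠ 0 →
      c * ‖z‖ ^ β ≤ ‖z ^ (β : ℂ) - s‖ ∧ c ≤ ‖z ^ (β : ℂ) - s‖ := by
  have hpi := Real.pi_pos
  set φ := |Complex.arg s| with hφ
  have hφpi : φ ≤ Real.pi := Complex.abs_arg_le_pi s
  set α := max 0 (Real.pi / 2 - φ) with hα
  have hα0 : 0 ≤ α := le_max_left _ _
  have hα1 : α + β * Real.pi / 2 < Real.pi / 2 := by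
    rcases max_cases 0 (Real.pi / 2 - φ) with ⟨h, _⟩ | ⟨h, _⟩
    · rw [hα, h]; nlinarith
    · rw [hα, h]; linarith
  have hα2 : Real.pi / 2 ≤ φ + α := by linarith [le_max_right 0 (Real.pi / 2 - φ)]
  have hα3 : φ + α ≤ Real.pi + Real.pi / 2 := by nlinarith
  obtain ⟨σ, hσ, hσs⟩ : ∃ σ : ℝ, |σ| = 1 ∧ Complex.arg s = σ * φ := by
    rcases le_total 0 (Complex.arg s) with h | h
    · exact ⟨1, by simp, by rw [hφ, abs_of_nonneg h, one_mul]⟩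
    · exact ⟨-1, by simp, by rw [hφ, abs_of_nonpos h]; ring⟩
  have hexp_re : ∀ w : ℂ, w ≠ 0 → ∀ b : ℝ,
      (Complex.exp ((σ * α : ℝ) * Complex.I) * w ^ (b : ℂ)).re =
      ‖w‖ ^ b * Real.cos (σ * α + b * Complex.arg w) := by
    intro w hw b
    rw [Complex.cpow_def_of_ne_zero hw, ← Complex.exp_add, Complex.exp_re]
    have h1 : ((σ * α : ℝ) * Complex.I + Complex.log w * b).re = Real.log ‖w‖ * b := by
      rw [Complex.add_re, Complex.re_mul_ofReal, Complex.log_re]; simp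
    have h2 : ((σ * α : ℝ) * Complex.I + Complex.log w * b).im =
        σ * α + b * Complex.arg w := by
      rw [Complex.add_im, Complex.im_mul_ofReal, Complex.log_im]; simp; ring
    rw [h1, h2, Real.rpow_def_of_pos (norm_pos_iff.2 hw)]
  set c₀ := Real.cos (α + β * Real.pi / 2) with hc₀
  have hc₀pos : 0 < c₀ := Real.cos_pos_of_mem_Ioo ⟨by nlinarith, hα1⟩
  have hs_re : (Complex.exp ((σ * α : ℝ) * Complex.I) * s).re ≤ 0 := by
    have h := hexp_re s hs 1
    rw [Complex.ofReal_one, Complex.cpow_one] at h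
    rw [h, hσs, show σ * α + 1 * (σ * φ) = σ * (φ + α) by ring]
    refine mul_nonpos_of_nonneg_of_nonpos (by positivity) ?_
    rw [← Real.cos_abs, abs_mul, hσ, one_mul, Real.cos_abs]
    exact Real.cos_nonpos_of_pi_div_two_le_of_le hα2 hα3
  have hmain : ∀ z : ℂ, 0 ≤ z.re → z ≠ 0 → c₀ * ‖z‖ ^ β ≤ ‖z ^ (β : ℂ) - s‖ := by
    intro z hz hz0
    have hcos : c₀ ≤ Real.cos (σ * α + β * Complex.arg z) := by
      rw [← Real.cos_abs (σ * α + β * Complex.arg z)]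
      have hargz := Complex.abs_arg_le_pi_div_two_iff.2 hz
      have hle : |σ * α + β * Complex.arg z| ≤ α + β * Real.pi / 2 := by
        refine (abs_add_le _ _).trans ?_
        rw [abs_mul, hσ, one_mul, abs_of_nonneg hα0, abs_mul, abs_of_pos hβ]
        nlinarith
      exact Real.cos_le_cos_of_nonneg_of_le_pi (abs_nonneg _) (by linarith) hle
    calc c₀ * ‖z‖ ^ β ≤ ‖z‖ ^ β * Real.cos (σ * α + β * Complex.arg z) := by
          rw [mul_comm]; gcongr
      _ = (Complex.exp ((σ * α : ℝ) * Complex.I) * z ^ (β : ℂ)).re := (hexp_re z hz0 β).symm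
      _ ≤ (Complex.exp ((σ * α : ℝ) * Complex.I) * (z ^ (β : ℂ) - s)).re := by
          rw [mul_sub, Complex.sub_re]; linarith
      _ ≤ ‖Complex.exp ((σ * α : ℝ) * Complex.I) * (z ^ (β : ℂ) - s)‖ := Complex.re_le_norm _
      _ = _ := by rw [norm_mul, Complex.norm_exp_ofReal_mul_I, one_mul]
  have hspos : 0 < ‖s‖ := norm_pos_iff.2 hs
  refine ⟨min c₀ (‖s‖ / (1 + 1 / c₀)), by positivity, fun z hz hz0 => ⟨?_, ?_⟩⟩
  · refine le_trans ?_ (hmain z hz hz0)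
    gcongr
    exact min_le_left _ _
  · refine (min_le_right _ _).trans ?_
    rw [div_le_iff₀ (by positivity)]
    have h1 : ‖s‖ ≤ ‖z ^ (β : ℂ)‖ + ‖z ^ (β : ℂ) - s‖ := by
      have := norm_sub_le (z ^ (β : ℂ)) (z ^ (β : ℂ) - s)
      simpa using this
    have h2 : ‖z ^ (β : ℂ)‖ = ‖z‖ ^ β := by
      rw [Complex.norm_cpow_of_ne_zero hz0]; simp
    have h3 : ‖z‖ ^ β ≤ ‖z ^ (β : ℂ) - s‖ * (1 / c₀) := by
      rw [mul_one_div, le_div_iff₀ hc₀pos, mul_comm]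
      exact hmain z hz hz0
    rw [h2] at h1
    linarith

lemma rpow_le_of_le_of_one_le {r p θ : ℝ} (hr : 0 ≤ r) (hp : r ≤ p) (h1 : 1 ≤ p)
    (hθ0 : 0 ≤ θ) (hθ1 : θ ≤ 1) : r ^ θ ≤ p := by
  rcases le_total r 1 with h | h
  · exact (Real.rpow_le_one hr h hθ0).trans h1
  · exact (Real.rpow_le_self_of_one_le h hθ1).trans hp

lemma norm_add_one_bounds {z : ℂ} (hz : 0 ≤ z.re) : ‖z‖ ≤ ‖z + 1‖ ∧ 1 ≤ ‖z + 1‖ := by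
  constructor
  · rw [Complex.norm_def, Complex.norm_def]
    apply Real.sqrt_le_sqrt
    simp only [Complex.normSq_apply, Complex.add_re, Complex.one_re, Complex.add_im,
      Complex.one_im, add_zero]
    nlinarith
  · refine le_trans ?_ (Complex.re_le_norm _)
    simpa using hz

/-- The Laplace transform of the difference between the solution of the fractional test equation
with initial value `1` and `exp (-t)`. -/
noncomputable def laplaceDiff (β : ℝ) (s z : ℂ) : ℂ :=
  (z ^ (β : ℂ) / z + s) / ((z ^ (β : ℂ) - s) * (z + 1))

/-- An integrable even function controlling `laplaceDiff` on vertical lines. -/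
noncomputable def decayBound (β y : ℝ) : ℝ := min (|y| ^ (β - 1)) (|y| ^ (-1 - β))

lemma decayBound_neg (β y : ℝ) : decayBound β (-y) = decayBound β y := by
  simp [decayBound]

lemma exists_norm_laplaceDiff_le {β : ℝ} (hβ : 0 < β) (hβ1 : β < 1) {s : ℂ} (hs : s ≠ 0)
    (harg : β * Real.pi / 2 < |Complex.arg s|) :
    ∃ C : ℝ, ∀ z : ℂ, 0 ≤ z.re → z.im ≠ 0 →
      ‖laplaceDiff β s z‖ ≤ C * decayBound β z.im := by
  obtain ⟨c, hc, hcz⟩ := exists_le_norm_cpow_sub hβ hβ1 hs harg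
  refine ⟨(1 + ‖s‖) / c, fun z hz him => ?_⟩
  have hz0 : z ≠ 0 := by rintro rfl; simp at him
  obtain ⟨hq1, hq2⟩ := hcz z hz hz0
  obtain ⟨hp1, hp2⟩ := norm_add_one_bounds hz
  have hr : 0 < ‖z‖ := norm_pos_iff.2 hz0
  have himz : |z.im| ≤ ‖z‖ := Complex.abs_im_le_norm z
  have him0 : 0 < |z.im| := abs_pos.2 him
  set r := ‖z‖
  set p := ‖z + 1‖
  set q := ‖z ^ (β : ℂ) - s‖
  have hp : 0 < p := by linarith
  have hq : 0 < q := by linarith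
  have hD : ‖laplaceDiff β s z‖ ≤ r ^ (β - 1) / (q * p) + ‖s‖ / (q * p) := by
    have hzβ : ‖z ^ (β : ℂ)‖ = r ^ β := by
      rw [Complex.norm_cpow_of_ne_zero hz0]; simp [r]
    rw [laplaceDiff, norm_div, norm_mul, ← add_div]
    gcongr
    refine (norm_add_le _ _).trans ?_
    rw [norm_div, hzβ, Real.rpow_sub_one hr.ne']
  have b1 : ‖laplaceDiff β s z‖ ≤ (1 + ‖s‖) / c * r ^ (β - 1) := by
    have h1 : r ^ (β - 1) / (q * p) ≤ r ^ (β - 1) / (c * 1) := by gcongr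
    have h2 : ‖s‖ / (q * p) ≤ ‖s‖ / (c * r ^ (1 - β)) := by
      gcongr
      exact rpow_le_of_le_of_one_le hr.le hp1 hp2 (by linarith) (by linarith)
    have h3 : r ^ (β - 1) = (r ^ (1 - β))⁻¹ := by rw [← Real.rpow_neg hr.le]; ring_nf
    have h4 : 0 < r ^ (1 - β) := by positivity
    calc _ ≤ r ^ (β - 1) / (c * 1) + ‖s‖ / (c * r ^ (1 - β)) := hD.trans (add_le_add h1 h2)
      _ = _ := by rw [h3]; field_simp
  have b2 : ‖laplaceDiff β s z‖ ≤ (1 + ‖s‖) / c * r ^ (-1 - β) := by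
    have h0 : 0 < r ^ β := by positivity
    have h1 : r ^ (β - 1) / (q * p) ≤ r ^ (β - 1) / ((c * r ^ β) * r ^ β) := by
      gcongr
      exact rpow_le_of_le_of_one_le hr.le hp1 hp2 hβ.le hβ1.le
    have h2 : ‖s‖ / (q * p) ≤ ‖s‖ / ((c * r ^ β) * r) := by gcongr
    have h3 : r ^ (-1 - β) = (r * r ^ β)⁻¹ := by
      rw [show -1 - β = -(1 + β) by ring, Real.rpow_neg hr.le, Real.rpow_add hr, Real.rpow_one]
    calc _ ≤ _ := hD.trans (add_le_add h1 h2)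
      _ = _ := by rw [h3, Real.rpow_sub_one hr.ne']; field_simp
  rw [decayBound, mul_min_of_nonneg _ _ (by positivity)]
  refine le_min (b1.trans ?_) (b2.trans ?_)
  · gcongr ?_ * ?_
    exact Real.rpow_le_rpow_of_nonpos him0 himz (by linarith)
  · gcongr ?_ * ?_
    exact Real.rpow_le_rpow_of_nonpos him0 himz (by linarith)

lemma integrable_decayBound {β : ℝ} (hβ : 0 < β) : Integrable (decayBound β) := by
  have hmeas : Measurable (decayBound β) := by unfold decayBound; fun_prop
  have hnn : ∀ y, 0 ≤ decayBound β y := fun y => by unfold decayBound; positivity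
  have hpos : IntegrableOn (decayBound β) (Ioi 0) := by
    rw [← Ioc_union_Ioi_eq_Ioi zero_le_one]
    refine IntegrableOn.union ?_ ?_
    · have h : IntegrableOn (fun y : ℝ => y ^ (β - 1)) (Ioc 0 1) :=
        (intervalIntegrable_iff_integrableOn_Ioc_of_le zero_le_one).1
          (intervalIntegral.intervalIntegrable_rpow' (by linarith))
      refine Integrable.mono' h hmeas.aestronglyMeasurable ?_
      filter_upwards [ae_restrict_mem measurableSet_Ioc] with y hy
      rw [Real.norm_of_nonneg (hnn y), decayBound, abs_of_pos hy.1]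
      exact min_le_left _ _
    · have h : IntegrableOn (fun y : ℝ => y ^ (-1 - β)) (Ioi 1) :=
        integrableOn_Ioi_rpow_of_lt (by linarith) one_pos
      refine Integrable.mono' h hmeas.aestronglyMeasurable ?_
      filter_upwards [ae_restrict_mem measurableSet_Ioi] with y hy
      rw [Real.norm_of_nonneg (hnn y), decayBound, abs_of_pos (one_pos.trans hy)]
      exact min_le_right _ _
  have hneg : IntegrableOn (decayBound β) (Iio 0) := by
    have h : IntegrableOn (fun y => decayBound β (-y)) (Iio 0) :=
      IntegrableOn.comp_neg_Iio (by simpa using hpos)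
    simpa only [decayBound_neg] using h
  rw [← integrableOn_univ, ← Iic_union_Ioi (a := (0 : ℝ))]
  exact ((integrableOn_Iic_iff_integrableOn_Iio).2 hneg).union hpos

lemma tendsto_decayBound_atTop {β : ℝ} (hβ : 0 < β) :
    Tendsto (decayBound β) atTop (𝓝 0) := by
  refine squeeze_zero' (Eventually.of_forall fun y => by unfold decayBound; positivity) ?_
    (tendsto_rpow_neg_atTop (y := 1 + β) (by linarith))
  filter_upwards [eventually_gt_atTop 0] with y hy
  rw [decayBound, abs_of_pos hy, neg_add']
  exact min_le_right _ _

/-- Shifting a vertical contour across a strip where the integrand is dominated by an even function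
of the height that is integrable and vanishes at infinity. -/
lemma integral_vertical_eq_of_bound {f : ℂ → ℂ} {x₁ x₂ : ℝ} (hx : x₁ ≤ x₂)
    (hf : DifferentiableOn ℂ f {z | z.re ∈ Icc x₁ x₂}) {g : ℝ → ℝ} (hg : Integrable g)
    (heven : ∀ y, g (-y) = g y) (hg0 : Tendsto g atTop (𝓝 0))
    (hfg : ∀ z : ℂ, z.re ∈ Icc x₁ x₂ → z.im ≠ 0 → ‖f z‖ ≤ g z.im) :
    ∫ y : ℝ, f (x₁ + y * Complex.I) = ∫ y : ℝ, f (x₂ + y * Complex.I) := by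
  have hne : ∀ᵐ y : ℝ, y ≠ 0 := by simp [ae_iff, measure_singleton]
  have hui : ∀ x ∈ Icc x₁ x₂, Integrable fun y : ℝ => f (x + y * Complex.I) := by
    intro x hx'
    refine hg.mono' (Continuous.aestronglyMeasurable ?_) ?_
    · refine hf.continuousOn.comp_continuous (by fun_prop) fun y => by simpa using hx'
    · filter_upwards [hne] with y hy
      simpa using hfg (x + y * Complex.I) (by simpa using hx') (by simpa using hy)
  have hvert : ∀ x ∈ Icc x₁ x₂, Tendsto (fun T : ℝ => ∫ y in (-T)..T, f (x + y * Complex.I))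
      atTop (𝓝 (∫ y : ℝ, f (x + y * Complex.I))) := fun x hx' =>
    intervalIntegral_tendsto_integral (hui x hx') tendsto_neg_atTop_atBot tendsto_id
  have hhor : ∀ σ : ℝ, |σ| = 1 → Tendsto (fun T : ℝ =>
      ∫ x in x₁..x₂, f (x + (σ * T : ℝ) * Complex.I)) atTop (𝓝 0) := by
    intro σ hσ
    have hlim := hg0.mul_const |x₂ - x₁|
    rw [zero_mul] at hlim
    refine squeeze_zero_norm' ?_ hlim
    filter_upwards [eventually_gt_atTop 0] with T hT
    refine intervalIntegral.norm_integral_le_of_norm_le_const fun x hx' => ?_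
    rw [uIoc_of_le hx] at hx'
    have hσ0 : σ ≠ 0 := by rintro rfl; simp at hσ
    have h := hfg (x + (σ * T : ℝ) * Complex.I) (by simpa using ⟨hx'.1.le, hx'.2⟩)
      (by simpa using ⟨hσ0, hT.ne'⟩)
    refine h.trans (le_of_eq ?_)
    rcases (abs_eq zero_le_one).1 hσ with rfl | rfl
    · simp
    · simp [heven]
  have hrect : ∀ T : ℝ, (∫ x in x₁..x₂, f (x + ((-1 : ℝ) * T : ℝ) * Complex.I)) -
      (∫ x in x₁..x₂, f (x + ((1 : ℝ) * T : ℝ) * Complex.I)) +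
      Complex.I • (∫ y in (-T)..T, f (x₂ + y * Complex.I)) -
      Complex.I • (∫ y in (-T)..T, f (x₁ + y * Complex.I)) = 0 := by
    intro T
    have h := Complex.integral_boundary_rect_eq_zero_of_differentiableOn f
      (x₁ + (-T : ℝ) * Complex.I) (x₂ + T * Complex.I) (hf.mono fun z hz => by
        have := hz.1
        simpa [uIcc_of_le hx] using this)
    simpa using h
  have hlim := (((hhor (-1) (by simp)).sub (hhor 1 (by simp))).add
    ((hvert x₂ ⟨hx, le_rfl⟩).const_smul Complex.I)).sub
    ((hvert x₁ ⟨le_rfl, hx⟩).const_smul Complex.I)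
  simp_rw [hrect] at hlim
  have h0 := tendsto_nhds_unique hlim tendsto_const_nhds
  simp only [sub_self, zero_add, smul_eq_mul, ← mul_sub] at h0
  exact (sub_eq_zero.1 ((mul_eq_zero.1 h0).resolve_left Complex.I_ne_zero)).symm

lemma differentiableAt_laplaceDiff {β : ℝ} {s z : ℂ} (hz : 0 ≤ z.re) (hzs : z ∈ Complex.slitPlane)
    (hne : z ^ (β : ℂ) - s ≠ 0) : DifferentiableAt ℂ (laplaceDiff β s) z := by
  have hz1 : z + 1 ≠ 0 := by
    intro h
    have := (norm_add_one_bounds hz).2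
    rw [h, norm_zero] at this
    linarith
  have hp : DifferentiableAt ℂ (fun w : ℂ => w ^ (β : ℂ)) z := differentiableAt_id.cpow_const hzs
  exact ((hp.div differentiableAt_id (Complex.slitPlane_ne_zero hzs)).add_const s).div
    ((hp.sub_const s).mul (differentiableAt_id.add_const 1)) (mul_ne_zero hne hz1)

/-- Scaled form of the vertical contour shift, for the inversion integral. -/
lemma integral_cexp_mul_laplaceDiff_eq {β : ℝ} (hβ : 0 < β) (hβ1 : β < 1) {s : ℂ} (hs : s ≠ 0)
    (harg : β * Real.pi / 2 < |Complex.arg s|) {t : ℝ} (ht : 0 ≤ t) {ε A : ℝ} (hε : 0 < ε)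
    (hεA : ε ≤ A) :
    ∫ v : ℝ, Complex.exp ((ε + (2 * Real.pi * v : ℝ) * Complex.I) * t) *
        laplaceDiff β s (ε + (2 * Real.pi * v : ℝ) * Complex.I) =
      ∫ v : ℝ, Complex.exp ((A + (2 * Real.pi * v : ℝ) * Complex.I) * t) *
        laplaceDiff β s (A + (2 * Real.pi * v : ℝ) * Complex.I) := by
  obtain ⟨C, hC⟩ := exists_norm_laplaceDiff_le hβ hβ1 hs harg
  obtain ⟨c, hc, hcz⟩ := exists_le_norm_cpow_sub hβ hβ1 hs harg
  have key := integral_vertical_eq_of_bound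
    (f := fun z => Complex.exp (z * t) * laplaceDiff β s z) hεA ?_
    (((integrable_decayBound hβ).const_mul C).const_mul (Real.exp (A * t)))
    (fun y => by simp only [decayBound_neg])
    (by simpa using ((tendsto_decayBound_atTop hβ).const_mul C).const_mul (Real.exp (A * t))) ?_
  · have h1 := Measure.integral_comp_mul_left
      (fun y : ℝ => Complex.exp ((ε + y * Complex.I) * t) *
        laplaceDiff β s (ε + y * Complex.I)) (2 * Real.pi)
    have h2 := Measure.integral_comp_mul_left
      (fun y : ℝ => Complex.exp ((A + y * Complex.I) * t) *
        laplaceDiff β s (A + y * Complex.I)) (2 * Real.pi)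
    rw [h1, h2, key]
  · intro z hz
    have hz' : 0 < z.re := hε.trans_le hz.1
    have hz0 : z ≠ 0 := by rintro rfl; simp at hz'
    refine DifferentiableAt.differentiableWithinAt (DifferentiableAt.mul (by fun_prop)
      (differentiableAt_laplaceDiff hz'.le (Or.inl hz') fun h => ?_))
    have := (hcz z hz'.le hz0).2
    rw [h, norm_zero] at this
    linarith
  · intro z hz him
    have h := hC z (hε.le.trans hz.1) him
    rw [norm_mul, Complex.norm_exp, Complex.re_mul_ofReal]
    have h2 : z.re * t ≤ A * t := mul_le_mul_of_nonneg_right hz.2 ht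
    gcongr

lemma laplace_sub_exp_eq {β : ℝ} (hβ : 0 < β) {s : ℂ} {u : ℝ → ℂ}
    (hsol : ∀ t : ℝ, 0 ≤ t → u t = u 0 + s * fracIntC β u t) {z : ℂ} (hz : 0 < z.re)
    (hui : IntegrableOn (fun t : ℝ => Complex.exp (-z * t) * u t) (Ioi 0))
    (hne : z ^ (β : ℂ) - s ≠ 0) :
    ∫ t : ℝ in Ioi 0, Complex.exp (-z * t) * (u t - u 0 * Complex.exp (-t)) =
      u 0 * laplaceDiff β s z := by
  have hz0 : z ≠ 0 := by rintro rfl; simp at hz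
  have hz1 : z + 1 ≠ 0 := by
    intro h
    have := congrArg Complex.re h
    simp at this
    linarith
  have hre : (-(z + 1)).re < 0 := by simp; linarith
  have h1 := laplace_fractional_test_equation hβ hsol hz hui
  have hsplit : ∀ t : ℝ, Complex.exp (-z * t) * (u t - u 0 * Complex.exp (-t)) =
      Complex.exp (-z * t) * u t - u 0 * Complex.exp (-(z + 1) * t) := by
    intro t
    have : Complex.exp (-(z + 1) * t) = Complex.exp (-z * t) * Complex.exp (-t) := by
      rw [← Complex.exp_add]; ring_nf
    rw [this]; ring
  simp_rw [hsplit]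
  rw [integral_sub hui ((integrableOn_exp_mul_complex_Ioi hre 0).const_mul _),
    integral_const_mul, integral_exp_mul_complex_Ioi hre 0, laplaceDiff]
  have h2 : ∫ t : ℝ in Ioi 0, Complex.exp (-z * t) * u t =
      u 0 * (z ^ (β : ℂ) / z) / (z ^ (β : ℂ) - s) := by
    rw [eq_div_iff hne, ← h1, mul_comm]
  rw [h2]
  simp only [Complex.ofReal_zero, mul_zero, Complex.exp_zero]
  field_simp
  ring

open FourierTransform in
/-- The inversion formula on the imaginary axis. -/
lemma sub_exp_eq_fourier {β : ℝ} (hβ : 0 < β) (hβ1 : β < 1) {s : ℂ} (hs : s ≠ 0)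
    {u : ℝ → ℂ} (hu : ContinuousOn u (Ici 0))
    (hsol : ∀ t : ℝ, 0 ≤ t → u t = u 0 + s * fracIntC β u t)
    (harg : β * Real.pi / 2 < |Complex.arg s|) {t : ℝ} (ht : 0 ≤ t) :
    u t - u 0 * Complex.exp (-t) =
      u 0 * 𝓕 (fun v : ℝ => laplaceDiff β s ((2 * Real.pi * v : ℝ) * Complex.I)) (-t) := by
  obtain ⟨C, hC⟩ := exists_norm_laplaceDiff_le hβ hβ1 hs harg
  obtain ⟨c, hc, hcz⟩ := exists_le_norm_cpow_sub hβ hβ1 hs harg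
  obtain ⟨M, a, ha, hM⟩ := exists_norm_le_mul_exp hβ hu hsol
  have hsub_ne : ∀ z : ℂ, 0 ≤ z.re → z ≠ 0 → z ^ (β : ℂ) - s ≠ 0 := by
    intro z hz hz0 h
    have := (hcz z hz hz0).2
    rw [h, norm_zero] at this
    linarith
  have hpi := Real.pi_pos
  have hne : ∀ᵐ v : ℝ, v ≠ 0 := by simp [ae_iff, measure_singleton]
  have hbint : Integrable fun v : ℝ => C * decayBound β (2 * Real.pi * v) :=
    ((integrable_decayBound hβ).comp_mul_left' (by positivity)).const_mul C
  set A := a + 1 with hA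
  have hA0 : 0 < A := by linarith
  -- the damped difference, extended by zero to the negative half-line
  set h : ℝ → ℂ := fun t =>
    Complex.exp (-A * t) * (u (max t 0) - u 0 * Complex.exp (-(max t 0 : ℝ))) with hh
  have hcont : Continuous h := by
    have : Continuous fun t : ℝ => u (max t 0) :=
      hu.comp_continuous (by fun_prop) fun t => mem_Ici.2 (le_max_right _ _)
    exact Continuous.mul (by fun_prop) (this.sub (by fun_prop))
  have hzero : ∀ t ∉ Ioi (0 : ℝ), h t = 0 := by
    intro t ht
    simp [hh, max_eq_right (notMem_Ioi.1 ht)]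
  have hpos : ∀ t ∈ Ici (0 : ℝ), h t = Complex.exp (-A * t) * (u t - u 0 * Complex.exp (-t)) := by
    intro t ht
    simp only [hh, max_eq_left (mem_Ici.1 ht)]
  have hintu : ∀ z : ℂ, a < z.re →
      IntegrableOn (fun t : ℝ => Complex.exp (-z * t) * u t) (Ioi 0) :=
    fun z hz => integrableOn_cexp_mul_of_le_exp hu hM hz
  have hhint : Integrable h := by
    rw [← integrableOn_iff_integrable_of_support_subset (s := Ioi 0)
      (fun t ht => by_contra fun hn => ht (hzero t hn))]
    have h1 := (hintu A (by simp [hA])).sub ((integrableOn_exp_mul_complex_Ioi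
      (a := -(A + 1 : ℂ)) (by simp; linarith) 0).const_mul (u 0))
    refine h1.congr_fun (fun t ht => ?_) measurableSet_Ioi
    rw [hpos t (le_of_lt (mem_Ioi.1 ht))]
    have : Complex.exp (-(A + 1) * t) = Complex.exp (-A * t) * Complex.exp (-t) := by
      rw [← Complex.exp_add]; ring_nf
    simp only [Pi.sub_apply, this]
    ring
  have hF : 𝓕 h = fun v : ℝ => u 0 * laplaceDiff β s (A + (2 * Real.pi * v : ℝ) * Complex.I) := by
    funext v
    have hzre : (A + (2 * Real.pi * v : ℝ) * Complex.I : ℂ).re = A := by simp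
    rw [← laplace_sub_exp_eq hβ hsol (by rw [hzre]; exact hA0)
      (hintu _ (by rw [hzre]; linarith)) (hsub_ne _ (by rw [hzre]; exact hA0.le) (by
        intro h0; rw [h0] at hzre; simp at hzre; linarith)),
      Real.fourier_eq', ← setIntegral_eq_integral_of_forall_compl_eq_zero (s := Ioi 0)
      (fun t ht => by rw [hzero t ht, smul_zero])]
    refine setIntegral_congr_fun measurableSet_Ioi fun t ht => ?_
    simp only [smul_eq_mul]
    rw [hpos t (le_of_lt (mem_Ioi.1 ht)), ← mul_assoc, ← Complex.exp_add]
    congr 2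
    simp only [RCLike.inner_apply, conj_trivial]
    push_cast
    ring
  have hmeas : ∀ x : ℝ, AEStronglyMeasurable
      (fun v : ℝ => laplaceDiff β s (x + (2 * Real.pi * v : ℝ) * Complex.I)) volume := by
    intro x
    refine Measurable.aestronglyMeasurable ?_
    unfold laplaceDiff
    fun_prop
  have hbound : ∀ x : ℝ, 0 ≤ x → ∀ᵐ v : ℝ,
      ‖laplaceDiff β s (x + (2 * Real.pi * v : ℝ) * Complex.I)‖ ≤
        C * decayBound β (2 * Real.pi * v) := by
    intro x hx
    filter_upwards [hne] with v hv
    have := hC (x + (2 * Real.pi * v : ℝ) * Complex.I) (by simpa using hx)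
      (by simpa using hv)
    simpa using this
  have hFint : Integrable (𝓕 h) := by
    rw [hF]
    exact (hbint.mono' (hmeas A) (hbound A hA0.le)).const_mul _
  have hinv := congrFun (hcont.fourierInv_fourier_eq hhint hFint) t
  rw [hF, Real.fourierInv_eq', hpos t ht] at hinv
  have hd : u t - u 0 * Complex.exp (-t) = u 0 *
      ∫ v : ℝ, Complex.exp ((A + (2 * Real.pi * v : ℝ) * Complex.I) * t) *
        laplaceDiff β s (A + (2 * Real.pi * v : ℝ) * Complex.I) := by
    have h1 : Complex.exp (A * t) * Complex.exp (-A * t) = 1 := by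
      rw [← Complex.exp_add]; simp
    rw [← one_mul (u t - _), ← h1, mul_assoc, ← hinv, ← integral_const_mul, ← integral_const_mul]
    congr 1 with v
    rw [add_mul, Complex.exp_add]
    simp only [smul_eq_mul, RCLike.inner_apply, conj_trivial]
    rw [show (((2 * Real.pi * (t * v) : ℝ) : ℂ) * Complex.I) =
      ((2 * Real.pi * v : ℝ) : ℂ) * Complex.I * t by push_cast; ring]
    ring
  have hlim : Tendsto (fun ε : ℝ => ∫ v : ℝ,
      Complex.exp ((ε + (2 * Real.pi * v : ℝ) * Complex.I) * t) *
        laplaceDiff β s (ε + (2 * Real.pi * v : ℝ) * Complex.I)) (𝓝[>] 0)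
      (𝓝 (∫ v : ℝ, Complex.exp (((0 : ℝ) + (2 * Real.pi * v : ℝ) * Complex.I) * t) *
        laplaceDiff β s ((0 : ℝ) + (2 * Real.pi * v : ℝ) * Complex.I))) := by
    refine tendsto_integral_filter_of_dominated_convergence
      (fun v => Real.exp t * (C * decayBound β (2 * Real.pi * v))) ?_ ?_
      (hbint.const_mul _) ?_
    · refine Eventually.of_forall fun ε => ?_
      exact AEStronglyMeasurable.mul (Measurable.aestronglyMeasurable (by fun_prop))
        (hmeas ε)
    · filter_upwards [Ioc_mem_nhdsGT zero_lt_one] with ε hε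
      filter_upwards [hbound ε hε.1.le] with v hv
      rw [norm_mul, Complex.norm_exp, Complex.re_mul_ofReal]
      have : (ε + (2 * Real.pi * v : ℝ) * Complex.I : ℂ).re * t ≤ t := by
        simpa using mul_le_of_le_one_left ht hε.2
      gcongr
    · filter_upwards [hne] with v hv
      have him : ((2 * Real.pi * v : ℝ) * Complex.I : ℂ).im ≠ 0 := by
        simpa using hv
      have hz0 : ((0 : ℝ) + (2 * Real.pi * v : ℝ) * Complex.I : ℂ) ≠ 0 := by
        intro h0; apply him; simpa using congrArg Complex.im h0
      have hD : ContinuousAt (laplaceDiff β s) ((0 : ℝ) + (2 * Real.pi * v : ℝ) * Complex.I) :=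
        (differentiableAt_laplaceDiff (by simp) (Or.inr (by simpa using him))
          (hsub_ne _ (by simp) hz0)).continuousAt
      have hpath : ContinuousAt (fun ε : ℝ => (ε + (2 * Real.pi * v : ℝ) * Complex.I : ℂ)) 0 := by
        fun_prop
      have : ContinuousAt (fun ε : ℝ =>
          Complex.exp ((ε + (2 * Real.pi * v : ℝ) * Complex.I) * t) *
          laplaceDiff β s (ε + (2 * Real.pi * v : ℝ) * Complex.I)) 0 :=
        ContinuousAt.mul (by fun_prop) (ContinuousAt.comp (f := fun ε : ℝ =>
          (ε + (2 * Real.pi * v : ℝ) * Complex.I : ℂ)) hD hpath)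
      exact this.tendsto.mono_left nhdsWithin_le_nhds
  have hconst : ∀ᶠ ε : ℝ in 𝓝[>] 0, (∫ v : ℝ,
      Complex.exp ((ε + (2 * Real.pi * v : ℝ) * Complex.I) * t) *
        laplaceDiff β s (ε + (2 * Real.pi * v : ℝ) * Complex.I)) =
      ∫ v : ℝ, Complex.exp ((A + (2 * Real.pi * v : ℝ) * Complex.I) * t) *
        laplaceDiff β s (A + (2 * Real.pi * v : ℝ) * Complex.I) := by
    filter_upwards [Ioc_mem_nhdsGT hA0] with ε hε
    exact integral_cexp_mul_laplaceDiff_eq hβ hβ1 hs harg ht hε.1 hε.2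
  rw [hd, ← tendsto_nhds_unique (hlim.congr' hconst) tendsto_const_nhds, Real.fourier_eq']
  congr 2 with v
  simp only [RCLike.inner_apply, conj_trivial, smul_eq_mul, Complex.ofReal_zero, zero_add]
  congr 2
  push_cast
  ring

lemma tendsto_zero_of_lt_abs_arg {β : ℝ} (hβ : 0 < β) (hβ1 : β < 1) {s : ℂ} (hs : s ≠ 0)
    {u : ℝ → ℂ} (hu : ContinuousOn u (Ici 0))
    (hsol : ∀ t : ℝ, 0 ≤ t → u t = u 0 + s * fracIntC β u t)
    (harg : β * Real.pi / 2 < |Complex.arg s|) : Tendsto u atTop (𝓝 0) := by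
  have h1 := ((Real.zero_at_infty_fourier
    (fun v : ℝ => laplaceDiff β s ((2 * Real.pi * v : ℝ) * Complex.I))).comp
    (tendsto_neg_atTop_atBot.mono_right atBot_le_cocompact)).const_mul (u 0)
  have h2 : Tendsto (fun t : ℝ => u 0 * Complex.exp (-t)) atTop (𝓝 0) := by
    have : Tendsto (fun t : ℝ => Complex.exp (-t)) atTop (𝓝 0) := by
      rw [tendsto_zero_iff_norm_tendsto_zero]
      simpa [Complex.norm_exp] using Real.tendsto_exp_neg_atTop_nhds_zero
    simpa using this.const_mul (u 0)
  have h3 := h1.add h2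
  rw [mul_zero, zero_add] at h3
  refine h3.congr' ?_
  filter_upwards [eventually_ge_atTop 0] with t ht
  rw [Function.comp_apply, ← sub_exp_eq_fourier hβ hβ1 hs hu hsol harg ht]
  ring

/-- Theorem 3.1: linear stability of the fractional test equation
`^CD_0^β u = s u` (in the integral form `u(t) = u(0) + s (I_0^β u)(t)`):
the zero steady state attracts all solutions iff `|arg s| > βπ/2`. -/
theorem fractional_test_equation_stability (β : ℝ) (hβ0 : 0 < β) (hβ1 : β < 1)
    (s : ℂ) (hs : s ≠ 0) (u : ℝ → ℂ) (hu : ContinuousOn u (Set.Ici 0))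
    (hsol : ∀ t : ℝ, 0 ≤ t → u t = u 0 + s * fracIntC β u t) :
    (β * Real.pi / 2 < |Complex.arg s| →
        Filter.Tendsto u Filter.atTop (nhds 0)) ∧
      (|Complex.arg s| ≤ β * Real.pi / 2 → u 0 ≠ 0 →
        ¬ Filter.Tendsto u Filter.atTop (nhds 0)) := by
  exact ⟨tendsto_zero_of_lt_abs_arg hβ0 hβ1 hs hu hsol,
    not_tendsto_zero_of_abs_arg_le hβ0 hs hu hsol⟩
end

section
/- Stability of convolution quadrature (Theorem 3.2): Let 0<β<1 and let (w_n)_{n≥0} be a complex sequence such that w_n = n^{β−1}/Γ(β+1) + v_n for n ≥ 1 with Σ_{n=1}^∞ |v_n| < ∞. Let W(z) = Σ_{n=0}^∞ w_n z^n, which converges for |z|<1, and let ξ ∈ ℂ be such that inf_{|z|<1} |1 − ξ W(z)| > 0. Then 1 − ξ w_0 ≠ 0, and for every convergent complex sequence (g_n)_{n≥0}, the sequence (y_n)_{n≥0} defined recursively by y_n = g_n + ξ Σ_{j=0}^{n} w_{n−j} y_j (i.e. (1 − ξ w_0) y_n = g_n + ξ Σ_{j=0}^{n−1} w_{n−j}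 y_j) is bounded. -/
open PowerSeries Finset

/-- The coefficient of `z ^ n` in the binomial series `(1 - z) ^ (-s)`. -/
noncomputable def negBinomCoeff (s : ℝ) (n : ℕ) : ℝ :=
  ∏ k ∈ range n, ((k : ℝ) + s) / ((k : ℝ) + 1)

lemma negBinomCoeff_zero (s : ℝ) : negBinomCoeff s 0 = 1 := by simp [negBinomCoeff]

lemma negBinomCoeff_succ (s : ℝ) (n : ℕ) :
    negBinomCoeff s (n + 1) = negBinomCoeff s n * (((n : ℝ) + s) / ((n : ℝ) + 1)) := by
  rw [negBinomCoeff, prod_range_succ, negBinomCoeff]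

lemma negBinomCoeff_nonneg {s : ℝ} (hs : 0 ≤ s) (n : ℕ) : 0 ≤ negBinomCoeff s n :=
  prod_nonneg fun k _ => by positivity

lemma negBinomCoeff_succ_le {s : ℝ} (hs : 0 ≤ s) (hs1 : s ≤ 1) (n : ℕ) :
    negBinomCoeff s (n + 1) ≤ negBinomCoeff s n := by
  rw [negBinomCoeff_succ]
  refine mul_le_of_le_one_right (negBinomCoeff_nonneg hs n) ?_
  rw [div_le_one (by positivity)]
  linarith

lemma negBinomCoeff_le_one {s : ℝ} (hs : 0 ≤ s) (hs1 : s ≤ 1) (n : ℕ) :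
    negBinomCoeff s n ≤ 1 := by
  simpa [negBinomCoeff_zero] using
    antitone_nat_of_succ_le (negBinomCoeff_succ_le hs hs1) (Nat.zero_le n)

lemma negBinomCoeff_eq_Gamma {s : ℝ} (hs : 0 < s) (n : ℕ) :
    negBinomCoeff s n = Real.Gamma (n + s) / (Real.Gamma s * Real.Gamma (n + 1)) := by
  have h0 := (Real.Gamma_pos_of_pos hs).ne'
  induction n with
  | zero => simp [negBinomCoeff_zero, h0]
  | succ n ih =>
    have h1 : (n : ℝ) + s ≠ 0 := by positivity
    have h2 : (n : ℝ) + 1 ≠ 0 := by positivity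
    have h3 := (Real.Gamma_pos_of_pos (show 0 < (n : ℝ) + 1 by positivity)).ne'
    rw [negBinomCoeff_succ, ih, Nat.cast_succ, Real.Gamma_add_one h2,
      show (n : ℝ) + 1 + s = n + s + 1 by ring, Real.Gamma_add_one h1]
    field_simp

lemma negBinomCoeff_neg_succ (s : ℝ) (n : ℕ) :
    negBinomCoeff (-s) (n + 1) = negBinomCoeff (1 - s) (n + 1) - negBinomCoeff (1 - s) n := by
  have key : negBinomCoeff (-s) (n + 1) = negBinomCoeff (1 - s) n * (-s / ((n : ℝ) + 1)) := by
    induction n with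
    | zero => simp [negBinomCoeff]
    | succ n ih =>
      rw [negBinomCoeff_succ, ih, negBinomCoeff_succ (1 - s) n]
      push_cast
      field_simp
      ring
  rw [key, negBinomCoeff_succ]
  field_simp
  ring

lemma summable_sub_succ_of_antitone {f : ℕ → ℝ} (hf : Antitone f) (h0 : ∀ n, 0 ≤ f n) :
    Summable fun n => f n - f (n + 1) := by
  refine summable_of_sum_range_le (c := f 0)
    (fun n => sub_nonneg.2 (hf n.le_succ)) fun n => ?_
  rw [sum_range_sub']
  linarith [h0 n]

lemma summable_abs_negBinomCoeff_neg {s : ℝ} (hs : 0 ≤ s) (hs1 : s ≤ 1) :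
    Summable fun n => |negBinomCoeff (-s) n| := by
  rw [← summable_nat_add_iff 1]
  have hle := negBinomCoeff_succ_le (s := 1 - s) (by linarith) (by linarith)
  refine (summable_sub_succ_of_antitone (antitone_nat_of_succ_le hle)
    (negBinomCoeff_nonneg (by linarith))).congr fun n => ?_
  rw [negBinomCoeff_neg_succ, abs_of_nonpos (by linarith [hle n])]
  ring

/-- The Gautschi inequality, upper bound. -/
lemma Gamma_add_le_Gamma_add_one_mul_rpow {x s : ℝ} (hx : 0 < x) (hs : 0 < s) (hs1 : s < 1) :
    Real.Gamma (x + s) ≤ Real.Gamma (x + 1) * x ^ (s - 1) := by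
  have hG := Real.Gamma_pos_of_pos hx
  have h := Real.Gamma_mul_add_mul_le_rpow_Gamma_mul_rpow_Gamma hx
    (show 0 < x + 1 by positivity) (show 0 < 1 - s by linarith) hs (by ring)
  rw [show (1 - s) * x + s * (x + 1) = x + s by ring, Real.Gamma_add_one hx.ne',
    Real.mul_rpow hx.le hG.le] at h
  have e1 : Real.Gamma x ^ (1 - s) * Real.Gamma x ^ s = Real.Gamma x := by
    rw [← Real.rpow_add hG]; simp
  have e2 : x * x ^ (s - 1) = x ^ s := by
    rw [← Real.rpow_one_add' hx.le (by linarith)]; congr 1; ring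
  rw [Real.Gamma_add_one hx.ne']
  linear_combination h + x ^ s * e1 - Real.Gamma x * e2

/-- The Gautschi inequality, lower bound. -/
lemma Gamma_add_one_mul_rpow_le_Gamma_add {x s : ℝ} (hx : 0 < x) (hs : 0 < s) (hs1 : s < 1) :
    Real.Gamma (x + 1) * (x + 1) ^ (s - 1) ≤ Real.Gamma (x + s) := by
  have hxs : 0 < x + s := by positivity
  have h := Gamma_add_le_Gamma_add_one_mul_rpow hxs (show 0 < 1 - s by linarith) (by linarith)
  rw [show x + s + (1 - s) = x + 1 by ring, Real.Gamma_add_one hxs.ne',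
    show 1 - s - 1 = -s by ring] at h
  have e1 : (x + s) * (x + s) ^ (-s) = (x + s) ^ (1 - s) := by
    rw [← Real.rpow_one_add' hxs.le (by linarith), sub_eq_add_neg]
  have hG := Real.Gamma_pos_of_pos hxs
  have h1 : Real.Gamma (x + 1) ≤ Real.Gamma (x + s) * (x + 1) ^ (1 - s) := by
    calc Real.Gamma (x + 1) ≤ Real.Gamma (x + s) * (x + s) ^ (1 - s) := by
          linear_combination h + Real.Gamma (x + s) * e1
      _ ≤ _ := by gcongr
  have hx1 : 0 < x + 1 := by positivity
  rw [show s - 1 = -(1 - s) by ring, Real.rpow_neg hx1.le, ← div_eq_mul_inv,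
    div_le_iff₀ (by positivity)]
  exact h1

lemma summable_abs_rpow_sub_negBinomCoeff {s : ℝ} (hs : 0 < s) (hs1 : s < 1) :
    Summable fun n : ℕ =>
      |((n : ℝ) + 1) ^ (s - 1) / Real.Gamma (s + 1) - negBinomCoeff s (n + 1) / s| := by
  have hanti : Antitone fun n : ℕ => ((n : ℝ) + 1) ^ (s - 1) := fun m n hmn =>
    Real.rpow_le_rpow_of_nonpos (by positivity) (by gcongr) (by linarith)
  refine ((summable_sub_succ_of_antitone hanti fun n => by positivity).div_const
    (Real.Gamma (s + 1))).of_nonneg_of_le (fun n => abs_nonneg _) fun n => ?_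
  have hn : (0 : ℝ) < (n : ℝ) + 1 := by positivity
  have h1 := Gamma_add_le_Gamma_add_one_mul_rpow hn hs hs1
  have h2 := Gamma_add_one_mul_rpow_le_Gamma_add hn hs hs1
  have hs0 := Real.Gamma_pos_of_pos hs
  have hn0 := Real.Gamma_pos_of_pos (show (0 : ℝ) < (n : ℝ) + 1 + 1 by positivity)
  rw [negBinomCoeff_eq_Gamma hs, Real.Gamma_add_one hs.ne', Nat.cast_succ]
  have e : ((n : ℝ) + 1) ^ (s - 1) / (s * Real.Gamma s) -
      Real.Gamma ((n : ℝ) + 1 + s) / (Real.Gamma s * Real.Gamma ((n : ℝ) + 1 + 1)) / s =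
      (((n : ℝ) + 1) ^ (s - 1) - Real.Gamma ((n : ℝ) + 1 + s) / Real.Gamma ((n : ℝ) + 1 + 1)) /
        (s * Real.Gamma s) := by
    field_simp
  rw [mul_comm, ← div_le_iff₀ hn0] at h1
  rw [mul_comm, ← le_div_iff₀ hn0] at h2
  rw [e, abs_of_nonneg (div_nonneg (by linarith) (by positivity))]
  gcongr

/-- The binomial series `(1 - z) ^ (-s)`. -/
noncomputable def negBinomSeries (s : ℝ) : PowerSeries ℝ := .mk (negBinomCoeff s)

lemma one_sub_X_mul_derivative_negBinomSeries (s : ℝ) :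
    (1 - X) * d⁄dX ℝ (negBinomSeries s) = C s * negBinomSeries s := by
  ext n
  rw [sub_mul, one_mul, map_sub, coeff_derivative, coeff_C_mul, negBinomSeries]
  cases n with
  | zero => simp [negBinomCoeff]
  | succ n =>
    rw [coeff_succ_X_mul, coeff_derivative, coeff_mk, coeff_mk, negBinomCoeff_succ s (n + 1)]
    push_cast
    field_simp
    ring

lemma negBinomSeries_neg_mul (s : ℝ) : negBinomSeries (-s) * negBinomSeries s = 1 := by
  refine derivative.ext ?_ ?_
  · have h : (1 - X : PowerSeries ℝ) ≠ 0 := fun h => by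
      simpa using congrArg (coeff 0) h
    refine mul_left_cancel₀ h ?_
    have h1 := one_sub_X_mul_derivative_negBinomSeries s
    have h2 := one_sub_X_mul_derivative_negBinomSeries (-s)
    rw [map_neg] at h2
    rw [Derivation.leibniz, Derivation.map_one_eq_zero, mul_zero, smul_eq_mul, smul_eq_mul]
    linear_combination negBinomSeries (-s) * h1 + negBinomSeries s * h2
  · simp [negBinomSeries, negBinomCoeff_zero]

lemma PowerSeries.tsum_coeff_mul_pow_mul {f g : PowerSeries ℂ} {z : ℂ}
    (hf : Summable fun n => ‖coeff n f * z ^ n‖) (hg : Summable fun n => ‖coeff n g * z ^ n‖) :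
    ∑' n, coeff n (f * g) * z ^ n = (∑' n, coeff n f * z ^ n) * ∑' n, coeff n g * z ^ n := by
  rw [tsum_mul_tsum_eq_tsum_sum_antidiagonal_of_summable_norm hf hg]
  refine tsum_congr fun n => ?_
  rw [coeff_mul, sum_mul]
  refine sum_congr rfl fun p hp => ?_
  rw [← mem_antidiagonal.1 hp, pow_add]
  ring

lemma PowerSeries.summable_norm_coeff_mul {f g : PowerSeries ℂ}
    (hf : Summable fun n => ‖coeff n f‖) (hg : Summable fun n => ‖coeff n g‖) :
    Summable fun n => ‖coeff n (f * g)‖ := by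
  simpa only [coeff_mul] using summable_norm_sum_mul_antidiagonal_of_summable_norm hf hg

lemma PowerSeries.summable_norm_coeff_mul_pow {f : PowerSeries ℂ}
    (hf : Summable fun n => ‖coeff n f‖) {z : ℂ} (hz : ‖z‖ ≤ 1) :
    Summable fun n => ‖coeff n f * z ^ n‖ := by
  refine hf.of_nonneg_of_le (fun n => norm_nonneg _) fun n => ?_
  rw [norm_mul, norm_pow]
  exact mul_le_of_le_one_right (norm_nonneg _) (pow_le_one₀ (norm_nonneg _) hz)

lemma PowerSeries.continuousOn_tsum_coeff_mul_pow {f : PowerSeries ℂ}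
    (hf : Summable fun n => ‖coeff n f‖) :
    ContinuousOn (fun z : ℂ => ∑' n, coeff n f * z ^ n) (Metric.closedBall 0 1) := by
  refine continuousOn_tsum (fun n => by fun_prop) hf fun n z hz => ?_
  rw [norm_mul, norm_pow]
  exact mul_le_of_le_one_right (norm_nonneg _)
    (pow_le_one₀ (norm_nonneg _) (mem_closedBall_zero_iff.1 hz))

section BanachAlgebra

lemma summable_smul_pow {A : Type*} [NormedRing A] [NormOneClass A] [NormedAlgebra ℂ A]
    [CompleteSpace A] {k : ℕ → ℂ} (hk : Summable fun n => ‖k n‖) {s : A} (hs : ‖s‖ ≤ 1) :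
    Summable fun n => k n • s ^ n := by
  refine Summable.of_norm_bounded hk fun n => ?_
  rw [norm_smul]
  exact mul_le_of_le_one_right (norm_nonneg _)
    ((norm_pow_le _ _).trans (pow_le_one₀ (norm_nonneg _) hs))

lemma isUnit_tsum_smul_pow_of_comm {A : Type*} [NormedCommRing A] [NormOneClass A]
    [NormedAlgebra ℂ A] [CompleteSpace A] {k : ℕ → ℂ} (hk : Summable fun n => ‖k n‖)
    (hne : ∀ z : ℂ, ‖z‖ ≤ 1 → ∑' n, k n * z ^ n ≠ 0) {s : A} (hs : ‖s‖ ≤ 1) :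
    IsUnit (∑' n, k n • s ^ n) := by
  by_contra h
  obtain ⟨φ, hφ⟩ := WeakDual.CharacterSpace.exists_apply_eq_zero h
  have hφs : ‖φ s‖ ≤ 1 :=
    (spectrum.norm_le_norm_of_mem (AlgHom.apply_mem_spectrum φ s)).trans hs
  refine hne (φ s) hφs ?_
  rw [← hφ, (summable_smul_pow hk hs).map_tsum φ (map_continuous φ)]
  simp

/-- **Wiener lemma** for power series in a contraction of a Banach algebra. -/
lemma isUnit_tsum_smul_pow {A : Type*} [NormedRing A] [NormOneClass A]
    [NormedAlgebra ℂ A] [CompleteSpace A] {k : ℕ → ℂ} (hk : Summable fun n => ‖k n‖)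
    (hne : ∀ z : ℂ, ‖z‖ ≤ 1 → ∑' n, k n * z ^ n ≠ 0) {s : A} (hs : ‖s‖ ≤ 1) :
    IsUnit (∑' n, k n • s ^ n) := by
  let B := Algebra.elemental ℂ s
  let _ : NormedCommRing B := { (inferInstance : NormedRing B) with mul_comm := mul_comm }
  have : NormOneClass B := ⟨norm_one (α := A)⟩
  let t : B := ⟨s, Algebra.elemental.self_mem ℂ s⟩
  have ht : ‖t‖ ≤ 1 := hs
  have h := (isUnit_tsum_smul_pow_of_comm hk hne ht).map B.val
  rwa [(summable_smul_pow hk ht).map_tsum B.val continuous_subtype_val] at h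

end BanachAlgebra

open scoped BoundedContinuousFunction

instance : Nontrivial (ℕ →ᵇ ℂ) :=
  ⟨0, .const ℕ 1, fun h => zero_ne_one (DFunLike.congr_fun h 0)⟩

/-- The right shift on bounded sequences. -/
noncomputable def rightShift : (ℕ →ᵇ ℂ) →L[ℂ] (ℕ →ᵇ ℂ) :=
  LinearMap.mkContinuous
    { toFun := fun f => .ofNormedAddCommGroupDiscrete
        (fun n => if n = 0 then 0 else f (n - 1)) ‖f‖ fun n => by
          split_ifs
          · simp
          · exact f.norm_coe_le_norm _
      map_add' := fun f g => by
        ext n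
        by_cases h : n = 0 <;> simp [h]
      map_smul' := fun c f => by
        ext n
        by_cases h : n = 0 <;> simp [h] } 1 fun f => by
    rw [one_mul, BoundedContinuousFunction.norm_le (norm_nonneg _)]
    intro n
    by_cases h : n = 0
    · simp [h]
    · simpa [h] using f.norm_coe_le_norm _

lemma rightShift_apply (f : ℕ →ᵇ ℂ) (n : ℕ) :
    rightShift f n = if n = 0 then 0 else f (n - 1) := rfl

lemma norm_rightShift_le : ‖rightShift‖ ≤ 1 :=
  LinearMap.mkContinuous_norm_le _ zero_le_one _

lemma rightShift_pow_apply (k : ℕ) (f : ℕ →ᵇ ℂ) (n : ℕ) :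
    (rightShift ^ k) f n = if k ≤ n then f (n - k) else 0 := by
  induction k generalizing n with
  | zero => simp
  | succ k ih =>
    rw [pow_succ', mul_apply_eq_comp, rightShift_apply, ih]
    cases n with
    | zero => simp
    | succ n => simp

lemma tsum_smul_rightShift_pow_apply {K : PowerSeries ℂ} (hK : Summable fun n => ‖coeff n K‖)
    (f : ℕ →ᵇ ℂ) (n : ℕ) :
    (∑' i, coeff i K • rightShift ^ i) f n = coeff n (K * .mk f) := by
  have h := summable_smul_pow (A := (ℕ →ᵇ ℂ) →L[ℂ] (ℕ →ᵇ ℂ)) hK norm_rightShift_le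
  let φ : ((ℕ →ᵇ ℂ) →L[ℂ] (ℕ →ᵇ ℂ)) →L[ℂ] ℂ :=
    (BoundedContinuousFunction.evalCLM ℂ n).comp (ContinuousLinearMap.apply ℂ _ f)
  change φ (∑' i, coeff i K • rightShift ^ i) = _
  rw [φ.map_tsum h, coeff_mul, Nat.sum_antidiagonal_eq_sum_range_succ
    fun i j => coeff i K * coeff j (PowerSeries.mk f)]
  rw [tsum_eq_sum (s := range n.succ)]
  · refine sum_congr rfl fun i hi => ?_
    have hi : i ≤ n := Nat.lt_succ_iff.1 (mem_range.1 hi)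
    change coeff i K • (rightShift ^ i) f n = _
    rw [rightShift_pow_apply, if_pos hi, coeff_mk, smul_eq_mul]
  · intro i hi
    have hi : ¬ i ≤ n := fun h => hi (mem_range.2 (Nat.lt_succ_iff.2 h))
    change coeff i K • (rightShift ^ i) f n = _
    rw [rightShift_pow_apply, if_neg hi, smul_zero]

/-- Division by an absolutely convergent power series without zeros in the closed unit disk
preserves boundedness of coefficients. -/
lemma PowerSeries.bounded_coeff_of_bounded_coeff_mul {K Y : PowerSeries ℂ}
    (hK : Summable fun n => ‖coeff n K‖)
    (hne : ∀ z : ℂ, ‖z‖ ≤ 1 → ∑' n, coeff n K * z ^ n ≠ 0) {M : ℝ}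
    (hM : ∀ n, ‖coeff n (K * Y)‖ ≤ M) : ∃ M' : ℝ, ∀ n, ‖coeff n Y‖ ≤ M' := by
  obtain ⟨T, hT⟩ := (isUnit_tsum_smul_pow (A := (ℕ →ᵇ ℂ) →L[ℂ] (ℕ →ᵇ ℂ)) hK hne
    norm_rightShift_le).exists_right_inv
  let h : ℕ →ᵇ ℂ := .ofNormedAddCommGroupDiscrete (fun n => coeff n (K * Y)) M hM
  have hY : K * .mk (T h) = K * Y := by
    ext n
    rw [← tsum_smul_rightShift_pow_apply hK, ← mul_apply_eq_comp, hT]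
    rfl
  have hK0 : K ≠ 0 := by
    rintro rfl
    simpa using hne 0 (by simp)
  refine ⟨‖T h‖, fun n => ?_⟩
  rw [← mul_left_cancel₀ hK0 hY, coeff_mk]
  exact (T h).norm_coe_le_norm n

lemma PowerSeries.norm_coeff_mul_le {f g : PowerSeries ℂ} (hf : Summable fun n => ‖coeff n f‖)
    {M : ℝ} (hg : ∀ n, ‖coeff n g‖ ≤ M) (n : ℕ) :
    ‖coeff n (f * g)‖ ≤ (∑' n, ‖coeff n f‖) * M := by
  have hM : 0 ≤ M := (norm_nonneg _).trans (hg 0)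
  rw [coeff_mul, Nat.sum_antidiagonal_eq_sum_range_succ fun i j => coeff i f * coeff j g]
  calc _ ≤ ∑ i ∈ range n.succ, ‖coeff i f‖ * M :=
        norm_sum_le_of_le _ fun i _ => by
          rw [norm_mul]
          gcongr
          exact hg _
    _ = (∑ i ∈ range n.succ, ‖coeff i f‖) * M := (sum_mul ..).symm
    _ ≤ _ := by
        gcongr
        exact hf.sum_le_tsum _ fun i _ => norm_nonneg _


/-- Theorem 3.2: stability of convolution quadrature.  If the weights satisfy
`w_n = n^{β−1}/Γ(β+1) + v_n` with `Σ|v_n| < ∞` and `1 − ξ W(z)` stays away from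
zero on the open unit disk, then the quadrature recursion with any convergent
inhomogeneity produces a bounded sequence. -/
theorem convolution_quadrature_stability (β : ℝ) (hβ0 : 0 < β) (hβ1 : β < 1)
    (w : ℕ → ℂ)
    (hsum : Summable fun n : ℕ =>
      ‖w (n + 1) - (((((n : ℝ) + 1) ^ (β - 1) / Real.Gamma (β + 1)) : ℝ) : ℂ)‖)
    (ξ : ℂ) (c : ℝ) (hc : 0 < c)
    (hinf : ∀ z : ℂ, ‖z‖ < 1 → c ≤ ‖1 - ξ * ∑' n : ℕ, w n * z ^ n‖) :
    1 - ξ * w 0 ≠ 0 ∧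
      ∀ g : ℕ → ℂ, (∃ gl : ℂ, Filter.Tendsto g Filter.atTop (nhds gl)) →
      ∀ y : ℕ → ℂ,
        (∀ n : ℕ, y n = g n + ξ * ∑ j ∈ Finset.range (n + 1), w (n - j) * y j) →
        ∃ M : ℝ, ∀ n : ℕ, ‖y n‖ ≤ M := by
  have hβ : (β : ℂ) ≠ 0 := by exact_mod_cast hβ0.ne'
  let A : PowerSeries ℂ := (negBinomSeries β).map Complex.ofRealHom
  let B : PowerSeries ℂ := (negBinomSeries (-β)).map Complex.ofRealHom
  have hBA : B * A = 1 := by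
    rw [← map_mul, negBinomSeries_neg_mul, map_one]
  have hA : ∀ n, coeff n A = (negBinomCoeff β n : ℂ) := fun n => by
    simp [A, negBinomSeries]
  have hB : Summable fun n => ‖coeff n B‖ := by
    refine (summable_abs_negBinomCoeff_neg hβ0.le hβ1.le).congr fun n => ?_
    simp [B, negBinomSeries]
  let W : PowerSeries ℂ := .mk w
  let U : PowerSeries ℂ := W - C (β : ℂ)⁻¹ * A
  have hU : Summable fun n => ‖coeff n U‖ := by
    rw [← summable_nat_add_iff 1]
    refine (hsum.add (summable_abs_rpow_sub_negBinomCoeff hβ0 hβ1)).of_nonneg_of_le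
      (fun n => norm_nonneg _) fun n => ?_
    rw [← Real.norm_eq_abs, ← Complex.norm_real]
    refine le_of_eq_of_le (congrArg norm ?_) (norm_add_le _ _)
    simp only [U, W, map_sub, coeff_C_mul, coeff_mk, hA]
    push_cast
    ring
  let K : PowerSeries ℂ := B * (1 - C ξ * W)
  have hKU : K = B - C (ξ * (β : ℂ)⁻¹) - C ξ * (B * U) := by
    simp only [K, U, map_mul]
    linear_combination (-C ξ * C (β : ℂ)⁻¹) * hBA
  have hBU := summable_norm_coeff_mul hB hU
  have hC : Summable fun n => ‖coeff n (C (ξ * (β : ℂ)⁻¹))‖ :=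
    summable_of_ne_finset_zero (s := {0}) fun n hn => by
      rw [coeff_C, if_neg (by simpa using hn), norm_zero]
  have hK : Summable fun n => ‖coeff n K‖ := by
    refine ((hB.add hC).add (hBU.mul_left ‖ξ‖)).of_nonneg_of_le (fun n => norm_nonneg _)
      fun n => ?_
    rw [hKU, map_sub, map_sub, coeff_C_mul, ← norm_mul]
    exact (norm_sub_le _ _).trans (by gcongr; exact norm_sub_le _ _)
  have hKz : ∀ z : ℂ, ‖z‖ ≤ 1 → ∑' n, coeff n K * z ^ n = (∑' n, coeff n B * z ^ n) -
      ξ * (β : ℂ)⁻¹ - ξ * ((∑' n, coeff n B * z ^ n) * ∑' n, coeff n U * z ^ n) := by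
    intro z hz
    have sB := summable_norm_coeff_mul_pow hB hz
    have sC := summable_norm_coeff_mul_pow hC hz
    have sBU := summable_norm_coeff_mul_pow hBU hz
    have tC : ∑' n, coeff n (C (ξ * (β : ℂ)⁻¹)) * z ^ n = ξ * (β : ℂ)⁻¹ := by
      rw [tsum_eq_single 0 fun n hn => by rw [coeff_C, if_neg hn, zero_mul]]
      simp
    rw [← tsum_coeff_mul_pow_mul sB (summable_norm_coeff_mul_pow hU hz), ← tsum_mul_left]
    nth_rw 1 [← tC]
    rw [← sB.of_norm.tsum_sub sC.of_norm,
      ← (sB.of_norm.sub sC.of_norm).tsum_sub (sBU.of_norm.mul_left ξ)]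
    refine tsum_congr fun n => ?_
    rw [hKU, map_sub, map_sub, coeff_C_mul]
    ring
  have hKin : ∀ z : ℂ, ‖z‖ < 1 →
      c * ‖∑' n, coeff n B * z ^ n‖ ≤ ‖∑' n, coeff n K * z ^ n‖ := by
    intro z hz
    have sB := summable_norm_coeff_mul_pow hB hz.le
    have sU := summable_norm_coeff_mul_pow hU hz.le
    have sA : Summable fun n => ‖coeff n A * z ^ n‖ := by
      refine (summable_geometric_of_lt_one (norm_nonneg z) hz).of_nonneg_of_le
        (fun n => norm_nonneg _) fun n => ?_
      rw [norm_mul, norm_pow, hA, Complex.norm_real, Real.norm_eq_abs,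
        abs_of_nonneg (negBinomCoeff_nonneg hβ0.le n)]
      exact mul_le_of_le_one_left (by positivity) (negBinomCoeff_le_one hβ0.le hβ1.le n)
    have tBA : (∑' n, coeff n B * z ^ n) * ∑' n, coeff n A * z ^ n = 1 := by
      rw [← tsum_coeff_mul_pow_mul sB sA, hBA,
        tsum_eq_single 0 fun n hn => by rw [coeff_one, if_neg hn, zero_mul]]
      simp
    have tW : ∑' n, w n * z ^ n =
        (∑' n, coeff n U * z ^ n) + (β : ℂ)⁻¹ * ∑' n, coeff n A * z ^ n := by
      rw [← tsum_mul_left, ← sU.of_norm.tsum_add (sA.of_norm.mul_left _)]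
      refine tsum_congr fun n => ?_
      simp only [U, W, map_sub, coeff_C_mul, coeff_mk]
      ring
    have e : ∑' n, coeff n K * z ^ n =
        (1 - ξ * ∑' n, w n * z ^ n) * ∑' n, coeff n B * z ^ n := by
      rw [hKz z hz.le, tW]
      linear_combination (ξ * (β : ℂ)⁻¹) * tBA
    rw [e, norm_mul]
    gcongr
    exact hinf z hz
  have hKcl : ∀ z : ℂ, ‖z‖ ≤ 1 →
      c * ‖∑' n, coeff n B * z ^ n‖ ≤ ‖∑' n, coeff n K * z ^ n‖ := by
    intro z hz
    have hcl : closure (Metric.ball (0 : ℂ) 1) = Metric.closedBall 0 1 :=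
      closure_ball 0 one_ne_zero
    refine le_on_closure (s := Metric.ball (0 : ℂ) 1)
      (fun x hx => hKin x (mem_ball_zero_iff.1 hx)) ?_ ?_
      (hcl ▸ mem_closedBall_zero_iff.2 hz) <;> rw [hcl]
    · exact continuousOn_const.mul (continuousOn_tsum_coeff_mul_pow hB).norm
    · exact (continuousOn_tsum_coeff_mul_pow hK).norm
  refine ⟨?_, ?_⟩
  · have h := hinf 0 (by simp)
    rw [tsum_eq_single 0 fun n hn => by simp [hn], pow_zero, mul_one] at h
    exact norm_pos_iff.1 (hc.trans_le h)
  rintro g ⟨gl, hg⟩ y hy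
  obtain ⟨M, hM⟩ := hg.norm.bddAbove_range
  have hM : ∀ n, ‖coeff n (.mk g : PowerSeries ℂ)‖ ≤ M := fun n => by
    rw [coeff_mk]
    exact hM ⟨n, rfl⟩
  have hG : (1 - C ξ * W) * .mk y = .mk g := by
    ext n
    rw [sub_mul, one_mul, mul_assoc, map_sub, coeff_C_mul, mul_comm W, coeff_mul,
      Nat.sum_antidiagonal_eq_sum_range_succ fun i j => coeff i (.mk y) * coeff j W]
    simp only [coeff_mk, W]
    rw [sub_eq_iff_eq_add, hy n]
    simp only [mul_comm]
  have hKY : K * .mk y = B * .mk g := by rw [← hG, ← mul_assoc]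
  by_cases hξ : ξ = 0
  · exact ⟨M, fun n => by simpa [hy n, hξ] using hM n⟩
  have hne : ∀ z : ℂ, ‖z‖ ≤ 1 → ∑' n, coeff n K * z ^ n ≠ 0 := by
    intro z hz h0
    have h := hKcl z hz
    rw [h0, norm_zero] at h
    have hB0 : ∑' n, coeff n B * z ^ n = 0 :=
      norm_le_zero_iff.1 (nonpos_of_mul_nonpos_right h hc)
    rw [hKz z hz, hB0] at h0
    simp [hξ, hβ] at h0
  obtain ⟨M', hM'⟩ := bounded_coeff_of_bounded_coeff_mul (Y := .mk y) hK hne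
    (hKY ▸ norm_coeff_mul_le hB hM)
  exact ⟨M', fun n => by simpa using hM' n⟩
end

section
/- Positivity and decay of the convolution weights (Lemma 6.1): Let 0<β<1 and let (ω_n^{(β)})_{n≥0} be the coefficients of the generating function ((1+z)/(2(1−z)))^β. Then ω_n^{(β)} > 0 for all n ≥ 0, and there exists a constant C>0 (depending only on β) such that ω_n^{(β)} ≤ C n^{β−1} for all n ≥ 1. -/
open PowerSeries in
/-- The binomial series `∑ C(β,i) z^i` satisfies `(1 + z) f' = β f`. -/
lemma one_add_X_mul_derivative_genBinom (β : ℝ) :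
    (1 + X) * derivative ℝ (mk (genBinom β)) = C β * mk (genBinom β) := by
  have hstep (i : ℕ) : genBinom β (i + 1) * ((i : ℝ) + 1) = (β - i) * genBinom β i := by
    have h1 : (Nat.factorial i : ℝ) ≠ 0 := by positivity
    have h2 : (i : ℝ) + 1 ≠ 0 := by positivity
    simp only [genBinom, Finset.prod_range_succ, Nat.factorial_succ]
    push_cast
    field_simp
  ext n
  rw [add_mul, one_mul, map_add, coeff_C_mul, coeff_derivative, coeff_mk, coeff_mk, hstep]
  cases n with
  | zero => simp
  | succ n =>
    rw [coeff_succ_X_mul, coeff_derivative, coeff_mk]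
    push_cast
    ring

open PowerSeries in
/-- The series `∑ Γ(β+k)/(Γ(β) k!) z^k` satisfies `(1 - z) f' = β f`. -/
lemma one_sub_X_mul_derivative_gamma {β : ℝ} (hβ : 0 < β) :
    (1 - X) * derivative ℝ (mk fun k : ℕ ↦
        Real.Gamma (β + k) / (Real.Gamma β * (Nat.factorial k : ℝ))) =
      C β * mk fun k : ℕ ↦ Real.Gamma (β + k) / (Real.Gamma β * (Nat.factorial k : ℝ)) := by
  set g : ℕ → ℝ := fun k ↦ Real.Gamma (β + k) / (Real.Gamma β * (Nat.factorial k : ℝ)) with hg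
  have hstep (i : ℕ) : g (i + 1) * ((i : ℝ) + 1) = (β + i) * g i := by
    have h1 : (Nat.factorial i : ℝ) ≠ 0 := by positivity
    have h2 : (i : ℝ) + 1 ≠ 0 := by positivity
    have h3 : Real.Gamma β ≠ 0 := (Real.Gamma_pos_of_pos hβ).ne'
    have h4 : Real.Gamma (β + (i + 1)) = (β + i) * Real.Gamma (β + i) := by
      rw [← add_assoc, Real.Gamma_add_one (by positivity)]
    simp only [hg, Nat.factorial_succ]
    push_cast
    rw [h4]
    field_simp
  ext n
  rw [sub_mul, one_mul, map_sub, coeff_C_mul, coeff_derivative, coeff_mk, coeff_mk, hstep]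
  cases n with
  | zero => simp
  | succ n =>
    rw [coeff_succ_X_mul, coeff_derivative, coeff_mk]
    push_cast
    ring

open PowerSeries in
lemma mk_omegaCoef_s8 (β : ℝ) :
    mk (omegaCoef β) = C ((2 : ℝ) ^ (-β)) * (mk (genBinom β) *
      mk fun k : ℕ ↦ Real.Gamma (β + k) / (Real.Gamma β * (Nat.factorial k : ℝ))) := by
  ext n
  rw [coeff_C_mul, coeff_mul, Finset.Nat.sum_antidiagonal_eq_sum_range_succ_mk, coeff_mk, omegaCoef]
  simp only [coeff_mk, mul_div_assoc]

open PowerSeries in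
/-- The generating function of the weights satisfies `(1 - z²) f' = 2 β f`. -/
lemma derivative_mk_omegaCoef {β : ℝ} (hβ : 0 < β) :
    derivative ℝ (mk (omegaCoef β)) =
      C (2 * β) * mk (omegaCoef β) + X * (X * derivative ℝ (mk (omegaCoef β))) := by
  have hA := one_add_X_mul_derivative_genBinom β
  have hB := one_sub_X_mul_derivative_gamma hβ
  rw [mk_omegaCoef_s8]
  simp only [Derivation.leibniz, smul_eq_mul, derivative_C, map_mul, map_ofNat]
  generalize (mk (genBinom β) : PowerSeries ℝ) = A at *
  generalize (mk fun k : ℕ ↦ Real.Gamma (β + k) /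
    (Real.Gamma β * (Nat.factorial k : ℝ)) : PowerSeries ℝ) = B at *
  linear_combination C ((2 : ℝ) ^ (-β)) * ((1 - X) * B * hA + (1 + X) * A * hB)

lemma omegaCoef_zero {β : ℝ} (hβ : 0 < β) : omegaCoef β 0 = (2 : ℝ) ^ (-β) := by
  simp [omegaCoef, genBinom, (Real.Gamma_pos_of_pos hβ).ne']

open PowerSeries in
lemma omegaCoef_one {β : ℝ} (hβ : 0 < β) : omegaCoef β 1 = 2 * β * omegaCoef β 0 := by
  have h := congrArg (coeff 0) (derivative_mk_omegaCoef hβ)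
  rw [map_add, coeff_C_mul, coeff_derivative, coeff_zero_X_mul, coeff_mk, coeff_mk] at h
  simpa using h

open PowerSeries in
lemma omegaCoef_add_two {β : ℝ} (hβ : 0 < β) (n : ℕ) :
    ((n : ℝ) + 2) * omegaCoef β (n + 2) =
      2 * β * omegaCoef β (n + 1) + n * omegaCoef β n := by
  have h := congrArg (coeff (n + 1)) (derivative_mk_omegaCoef hβ)
  rw [map_add, coeff_C_mul, coeff_derivative, coeff_succ_X_mul, coeff_mk, coeff_mk] at h
  cases n with
  | zero =>
    rw [coeff_zero_X_mul] at h
    push_cast at h ⊢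
    linear_combination h
  | succ n =>
    rw [coeff_succ_X_mul, coeff_derivative, coeff_mk] at h
    push_cast at h ⊢
    linear_combination h

lemma omegaCoef_pos {β : ℝ} (hβ : 0 < β) (n : ℕ) : 0 < omegaCoef β n := by
  induction n using Nat.twoStepInduction with
  | zero => rw [omegaCoef_zero hβ]; positivity
  | one => rw [omegaCoef_one hβ, omegaCoef_zero hβ]; positivity
  | more n h0 h1 =>
    have h2 : 0 < ((n : ℝ) + 2) * omegaCoef β (n + 2) := by
      rw [omegaCoef_add_two hβ]; positivity
    exact pos_of_mul_pos_right h2 (by positivity)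

lemma two_le_one_add_rpow_add_one_sub_rpow {p t : ℝ} (hp : p ≤ 0) (ht0 : 0 ≤ t) (ht1 : t < 1) :
    2 ≤ (1 + t) ^ p + (1 - t) ^ p := by
  have hu : 0 < (1 + t) ^ p := Real.rpow_pos_of_pos (by linarith) p
  have hv : 0 < (1 - t) ^ p := Real.rpow_pos_of_pos (by linarith) p
  have huv : 1 ≤ (1 + t) ^ p * (1 - t) ^ p := by
    rw [← Real.mul_rpow (by linarith) (by linarith)]
    exact Real.one_le_rpow_of_pos_of_le_one_of_nonpos (by nlinarith) (by nlinarith) hp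
  nlinarith [sq_nonneg ((1 + t) ^ p - (1 - t) ^ p)]

lemma two_mul_mul_le_one_add_rpow_sub_one_sub_rpow {β t : ℝ} (hβ0 : 0 < β) (hβ1 : β ≤ 1)
    (ht0 : 0 ≤ t) (ht1 : t ≤ 1) : 2 * β * t ≤ (1 + t) ^ β - (1 - t) ^ β := by
  have hderiv : ∀ x ∈ interior (Set.Icc (0 : ℝ) 1),
      HasDerivAt (fun s : ℝ ↦ (1 + s) ^ β - (1 - s) ^ β - 2 * β * s)
        (β * ((1 + x) ^ (β - 1) + (1 - x) ^ (β - 1) - 2)) x := by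
    intro x hx
    rw [interior_Icc] at hx
    have h1 := ((hasDerivAt_id x).const_add 1).rpow_const (p := β)
      (Or.inl (by simp only [id]; linarith [hx.1]))
    have h2 := ((hasDerivAt_id x).const_sub 1).rpow_const (p := β)
      (Or.inl (by simp only [id]; linarith [hx.2]))
    refine ((h1.sub h2).sub ((hasDerivAt_id x).const_mul (2 * β))).congr_deriv ?_
    simp only [id]
    ring
  have hmono : MonotoneOn (fun s : ℝ ↦ (1 + s) ^ β - (1 - s) ^ β - 2 * β * s)
      (Set.Icc 0 1) := by
    refine monotoneOn_of_deriv_nonneg (convex_Icc 0 1) ?_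
      (fun x hx ↦ (hderiv x hx).differentiableAt.differentiableWithinAt) fun x hx ↦ ?_
    · refine Continuous.continuousOn ?_
      exact (((continuous_const.add continuous_id).rpow_const fun _ ↦ Or.inr hβ0.le).sub
        ((continuous_const.sub continuous_id).rpow_const fun _ ↦ Or.inr hβ0.le)).sub
        (continuous_const.mul continuous_id)
    · rw [(hderiv x hx).deriv]
      rw [interior_Icc] at hx
      have := two_le_one_add_rpow_add_one_sub_rpow (p := β - 1) (by linarith) hx.1.le hx.2
      exact mul_nonneg hβ0.le (by linarith)
  have h := hmono (Set.left_mem_Icc.2 zero_le_one) ⟨ht0, ht1⟩ ht0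
  norm_num at h
  linarith

lemma two_mul_mul_rpow_le_add_one_rpow_sub_sub_one_rpow {β x : ℝ} (hβ0 : 0 < β) (hβ1 : β ≤ 1)
    (hx : 1 ≤ x) : 2 * β * x ^ (β - 1) ≤ (x + 1) ^ β - (x - 1) ^ β := by
  have hx0 : 0 < x := by linarith
  have hinv : x⁻¹ ≤ 1 := inv_le_one_of_one_le₀ hx
  have hinv0 : 0 < x⁻¹ := inv_pos.2 hx0
  have h := mul_le_mul_of_nonneg_left
    (two_mul_mul_le_one_add_rpow_sub_one_sub_rpow hβ0 hβ1 hinv0.le hinv)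
    (Real.rpow_nonneg hx0.le β)
  rw [mul_sub, ← Real.mul_rpow hx0.le (by linarith), ← Real.mul_rpow hx0.le (by linarith),
    mul_add, mul_sub, mul_inv_cancel₀ hx0.ne', mul_one] at h
  rw [Real.rpow_sub_one hx0.ne', div_eq_mul_inv]
  linarith

lemma natCast_mul_omegaCoef_le {β : ℝ} (hβ0 : 0 < β) (hβ1 : β ≤ 1) (n : ℕ) :
    n * omegaCoef β n ≤ 2 * β * omegaCoef β 0 * (n : ℝ) ^ β := by
  induction n using Nat.twoStepInduction with
  | zero => simp [hβ0.ne']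
  | one => simp [omegaCoef_one hβ0]
  | more n h0 h1 =>
    have hC : 0 < 2 * β * omegaCoef β 0 := by have := omegaCoef_pos hβ0 0; positivity
    have hn : 0 < (n : ℝ) + 1 := by positivity
    have hgap := two_mul_mul_rpow_le_add_one_rpow_sub_sub_one_rpow (x := n + 1) hβ0 hβ1 (by simp)
    rw [add_sub_cancel_right, add_assoc, one_add_one_eq_two] at hgap
    have h1' : omegaCoef β (n + 1) ≤ 2 * β * omegaCoef β 0 * ((n : ℝ) + 1) ^ (β - 1) := by
      rw [Real.rpow_sub_one hn.ne', ← mul_div_assoc, le_div_iff₀ hn]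
      push_cast at h1
      linarith
    have hrec := omegaCoef_add_two hβ0 n
    push_cast
    have h2 := mul_le_mul_of_nonneg_left h1' (by positivity : 0 ≤ 2 * β)
    have h3 := mul_le_mul_of_nonneg_left hgap hC.le
    linarith

/-- Lemma 6.1: the convolution weights are positive and decay like `n^{β−1}`. -/
theorem omegaCoef_pos_and_decay (β : ℝ) (hβ0 : 0 < β) (hβ1 : β < 1) :
    (∀ n : ℕ, 0 < omegaCoef β n) ∧
      ∃ C : ℝ, 0 < C ∧ ∀ n : ℕ, 1 ≤ n → omegaCoef β n ≤ C * (n : ℝ) ^ (β - 1) := by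
  have h0 := omegaCoef_pos hβ0 0
  refine ⟨omegaCoef_pos hβ0, 2 * β * omegaCoef β 0, by positivity, fun n hn ↦ ?_⟩
  have hn0 : (0 : ℝ) < n := by exact_mod_cast hn
  rw [Real.rpow_sub_one hn0.ne', ← mul_div_assoc, le_div_iff₀ hn0, mul_comm]
  exact natCast_mul_omegaCoef_le hβ0 hβ1.le n
end

section
/- Bounds on the Taylor correction weights (equation (2.34)): Let m̃ be a positive integer, let 0<δ_1<⋯<δ_{m̃} and 0<σ_1<⋯<σ_{m̃'} be strictly increasing positive exponents, and for each integer n ≥ 2 let W̃_{n,k}^{(f)} (k=1,…,m̃) be the unique solution of Σ_{k=1}^{m̃} W̃_{n,k}^{(f)} k^{δ_r} = n^{δ_r} − (n−1)^{δ_r} − δ_r(n−1)^{δ_r−1}, r=1,…,m̃, and let W̃_{n,k}^{(u)} (k=1,…,m̃') be the unique solution of Σ_{k=1}^{m̃'} W̃_{n,k}^{(u)} k^{σ_r} = σ_r(n−1)^{σ_r−1} − (n^{σ_r} − (n−1)^{σ_r}), r=1,…,m̃'. Then there exists a constant C>0, independent of n, such that |W̃_{n,k}^{(f)}| ≤ C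 n^{δ_{m̃}−2} for all n ≥ 2 and 1 ≤ k ≤ m̃, and |W̃_{n,k}^{(u)}| ≤ C n^{σ_{m̃'}−2} for all n ≥ 2 and 1 ≤ k ≤ m̃'. -/
/-- `W` solves the Vandermonde system defining the Taylor correction weights
`W̃_{n,k}^{(f)}`, `k = 1,…,m̃`. -/
def IsTaylorFWeights (δ : ℕ → ℝ) (m n : ℕ) (W : ℕ → ℝ) : Prop :=
  ∀ r ∈ Finset.Icc 1 m,
    ∑ k ∈ Finset.Icc 1 m, W k * (k : ℝ) ^ (δ r) =
      (n : ℝ) ^ (δ r) - ((n : ℝ) - 1) ^ (δ r) - δ r * ((n : ℝ) - 1) ^ (δ r - 1)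

/-- `W` solves the Vandermonde system defining the Taylor correction weights
`W̃_{n,k}^{(u)}`, `k = 1,…,m̃'`. -/
def IsTaylorUWeights (σ : ℕ → ℝ) (m n : ℕ) (W : ℕ → ℝ) : Prop :=
  ∀ r ∈ Finset.Icc 1 m,
    ∑ k ∈ Finset.Icc 1 m, W k * (k : ℝ) ^ (σ r) =
      σ r * ((n : ℝ) - 1) ^ (σ r - 1) - ((n : ℝ) ^ (σ r) - ((n : ℝ) - 1) ^ (σ r))

/-- A nontrivial real exponential sum with `m` distinct frequencies has fewer than `m` zeros. -/
theorem expSum_coeff_eq_zero {ι : Type*} {d : ι → ℝ} (hd : Function.Injective d) {m : ℕ}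
    {S : Finset ι} (hS : S.card = m) {c : ι → ℝ} {x : Fin m → ℝ} (hx : StrictMono x)
    (h : ∀ i, ∑ s ∈ S, c s * Real.exp (d s * x i) = 0) : ∀ s ∈ S, c s = 0 := by
  classical
  induction m generalizing S c with
  | zero =>
    intro s hs
    simp [Finset.card_eq_zero.mp hS] at hs
  | succ m ih =>
    obtain ⟨a, T, haT, rfl, hT⟩ := Finset.card_eq_succ.mp hS
    have hf : ∀ t, HasDerivAt (fun t ↦ ∑ s ∈ insert a T, c s * Real.exp ((d s - d a) * t))
        (∑ s ∈ insert a T, c s * (Real.exp ((d s - d a) * t) * (d s - d a))) t := fun t ↦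
      HasDerivAt.fun_sum fun s _ ↦
        (((hasDerivAt_id t).const_mul (d s - d a)).exp.const_mul (c s)).congr_deriv (by simp)
    have hzero : ∀ i, ∑ s ∈ insert a T, c s * Real.exp ((d s - d a) * x i) = 0 := fun i ↦ by
      have := congrArg (· * Real.exp (-(d a * x i))) (h i)
      simp only [Finset.sum_mul, zero_mul] at this
      rw [← this]
      refine Finset.sum_congr rfl fun s _ ↦ ?_
      rw [mul_assoc, ← Real.exp_add]
      ring_nf
    have hrolle : ∀ i : Fin m, ∃ y ∈ Set.Ioo (x i.castSucc) (x i.succ),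
        ∑ s ∈ insert a T, c s * (Real.exp ((d s - d a) * y) * (d s - d a)) = 0 := fun i ↦
      exists_hasDerivAt_eq_zero (hx i.castSucc_lt_succ)
        (fun t _ ↦ (hf t).continuousAt.continuousWithinAt)
        ((hzero _).trans (hzero _).symm) fun t _ ↦ hf t
    choose y hy hy0 using hrolle
    have hymono : StrictMono y := fun i j hij ↦
      (hy i).2.trans_le ((hx.monotone (Fin.succ_le_castSucc_iff.mpr hij)).trans (hy j).1.le)
    have hcT : ∀ s ∈ T, c s = 0 := fun s hs ↦ by
      have h0 := ih hT (c := fun s ↦ c s * (d s - d a)) hymono (fun i ↦ by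
        have := congrArg (· * Real.exp (d a * y i)) (hy0 i)
        simp only [Finset.sum_insert haT, sub_self, mul_zero, zero_add, Finset.sum_mul,
          zero_mul] at this
        rw [← this]
        refine Finset.sum_congr rfl fun s _ ↦ ?_
        have he : Real.exp (d s * y i) =
            Real.exp ((d s - d a) * y i) * Real.exp (d a * y i) := by
          rw [← Real.exp_add]; ring_nf
        rw [he]; ring) s hs
      refine (mul_eq_zero.mp h0).resolve_right (sub_ne_zero.mpr fun e ↦ haT ?_)
      exact hd e ▸ hs
    intro s hs
    rcases Finset.mem_insert.mp hs with rfl | hs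
    · have := h 0
      rw [Finset.sum_insert haT, Finset.sum_eq_zero fun t ht ↦ by rw [hcT t ht, zero_mul],
        add_zero] at this
      exact (mul_eq_zero.mp this).resolve_right (Real.exp_ne_zero _)
    · exact hcT s hs

/-- The generalized Vandermonde matrix `(k ^ δ_r)`, `1 ≤ r, k ≤ m`, is invertible. -/
theorem isUnit_generalizedVandermonde {m : ℕ} {δ : ℕ → ℝ} (hδ : Set.InjOn δ (Set.Icc 1 m)) :
    IsUnit (Matrix.of fun r k : Finset.Icc 1 m ↦ ((k : ℕ) : ℝ) ^ δ r) := by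
  rw [← Matrix.vecMul_injective_iff_isUnit]
  refine (injective_iff_map_eq_zero (Matrix.vecMulLinear
    (Matrix.of fun r k : Finset.Icc 1 m ↦ ((k : ℕ) : ℝ) ^ δ r))).mpr fun c hc ↦ ?_
  have hinj : Function.Injective fun r : Finset.Icc 1 m ↦ δ r := fun r s h ↦
    Subtype.ext (hδ (Finset.mem_Icc.mp r.2) (Finset.mem_Icc.mp s.2) h)
  have hlog : StrictMono fun i : Fin m ↦ Real.log ((i + 1 : ℕ) : ℝ) := fun i j hij ↦
    Real.log_lt_log (by positivity) (by exact_mod_cast Nat.succ_lt_succ hij)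
  funext s
  refine expSum_coeff_eq_zero hinj (S := Finset.univ) (by simp) hlog (fun i ↦ ?_) s
    (Finset.mem_univ s)
  have := congrFun hc ⟨i + 1, Finset.mem_Icc.mpr ⟨by omega, i.2⟩⟩
  simp only [Matrix.vecMulLinear_apply, Matrix.vecMul, dotProduct, Matrix.of_apply,
    Pi.zero_apply] at this
  rw [← this]
  refine Finset.sum_congr rfl fun r _ ↦ ?_
  rw [Real.rpow_def_of_pos (by positivity), mul_comm (δ r)]

theorem rpow_le_two_rpow_abs_mul_rpow {y z : ℝ} (hz : 0 < z) (hzy : z / 2 ≤ y) (hyz : y ≤ z)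
    (p : ℝ) : y ^ p ≤ 2 ^ |p| * z ^ p := by
  have hy : 0 < y := by linarith
  rcases le_total 0 p with hp | hp
  · calc y ^ p ≤ z ^ p := Real.rpow_le_rpow hy.le hyz hp
      _ ≤ 2 ^ |p| * z ^ p := le_mul_of_one_le_left (by positivity)
        (Real.one_le_rpow one_le_two (abs_nonneg p))
  · calc y ^ p ≤ (z / 2) ^ p := Real.rpow_le_rpow_of_nonpos (by positivity) hzy hp
      _ = 2 ^ |p| * z ^ p := by
        rw [Real.div_rpow hz.le zero_le_two, abs_of_nonpos hp, Real.rpow_neg zero_le_two]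
        field_simp

theorem abs_rpow_sub_taylor_le (p : ℝ) {z : ℝ} (hz : 2 ≤ z) :
    |z ^ p - (z - 1) ^ p - p * (z - 1) ^ (p - 1)| ≤
      |p * (p - 1)| * 2 ^ |p - 2| * z ^ (p - 2) := by
  have hderiv : ∀ q t : ℝ, z - 1 ≤ t → HasDerivAt (fun t : ℝ ↦ t ^ q) (q * t ^ (q - 1)) t :=
    fun q t ht ↦ Real.hasDerivAt_rpow_const (Or.inl (by linarith))
  obtain ⟨ξ, hξ, hξeq⟩ := exists_hasDerivAt_eq_slope _ _ (show z - 1 < z by linarith)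
    (fun t ht ↦ (hderiv p t ht.1).continuousAt.continuousWithinAt)
    (fun t ht ↦ hderiv p t ht.1.le)
  obtain ⟨η, hη, hηeq⟩ := exists_hasDerivAt_eq_slope _ _ hξ.1
    (fun t ht ↦ (hderiv (p - 1) t ht.1).continuousAt.continuousWithinAt)
    (fun t ht ↦ hderiv (p - 1) t ht.1.le)
  rw [sub_sub_cancel, div_one] at hξeq
  rw [eq_div_iff (by linarith [hξ.1]), sub_sub, one_add_one_eq_two] at hηeq
  have heq : z ^ p - (z - 1) ^ p - p * (z - 1) ^ (p - 1) =
      p * (p - 1) * (η ^ (p - 2) * (ξ - (z - 1))) := by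
    rw [← hξeq]; linear_combination -p * hηeq
  have hη0 : 0 < η := by linarith [hη.1]
  have hξ1 : 0 ≤ ξ - (z - 1) := by linarith [hξ.1]
  rw [heq, abs_mul, abs_of_nonneg (mul_nonneg (by positivity) hξ1), mul_assoc]
  refine mul_le_mul_of_nonneg_left ?_ (abs_nonneg _)
  calc η ^ (p - 2) * (ξ - (z - 1)) ≤ η ^ (p - 2) * 1 := by
        gcongr; linarith [hξ.2]
    _ ≤ 2 ^ |p - 2| * z ^ (p - 2) := by
        rw [mul_one]
        exact rpow_le_two_rpow_abs_mul_rpow (by linarith) (by linarith [hη.1])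
          (by linarith [hη.2, hξ.2]) _

theorem IsTaylorUWeights.neg {σ : ℕ → ℝ} {m n : ℕ} {W : ℕ → ℝ} (h : IsTaylorUWeights σ m n W) :
    IsTaylorFWeights σ m n (-W) := fun r hr ↦ by
  simp only [Pi.neg_apply, neg_mul, Finset.sum_neg_distrib, h r hr]
  ring

theorem IsTaylorFWeights.exists_bound {m : ℕ} {δ : ℕ → ℝ}
    (hδ : StrictMonoOn δ (Set.Icc 1 m)) :
    ∃ C : ℝ, 0 < C ∧ ∀ n : ℕ, 2 ≤ n → ∀ W : ℕ → ℝ, IsTaylorFWeights δ m n W →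
      ∀ k ∈ Finset.Icc 1 m, |W k| ≤ C * (n : ℝ) ^ (δ m - 2) := by
  set A := Matrix.of fun r k : Finset.Icc 1 m ↦ ((k : ℕ) : ℝ) ^ δ r with hA
  have hunit : IsUnit A.det :=
    (Matrix.isUnit_iff_isUnit_det A).mp (isUnit_generalizedVandermonde hδ.injOn)
  set K : Finset.Icc 1 m → ℝ := fun r ↦ |δ r * (δ r - 1)| * 2 ^ |δ r - 2|
  have hK : ∀ r, 0 ≤ K r := fun r ↦ by positivity
  refine ⟨∑ k, ∑ r, |A⁻¹ k r| * K r + 1, ?_, fun n hn W hW k hk ↦ ?_⟩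
  · have : 0 ≤ ∑ k, ∑ r, |A⁻¹ k r| * K r :=
      Finset.sum_nonneg fun _ _ ↦ Finset.sum_nonneg fun r _ ↦ mul_nonneg (abs_nonneg _) (hK r)
    linarith
  have hn' : (2 : ℝ) ≤ n := by exact_mod_cast hn
  set b : Finset.Icc 1 m → ℝ := fun r ↦
    (n : ℝ) ^ δ r - ((n : ℝ) - 1) ^ δ r - δ r * ((n : ℝ) - 1) ^ (δ r - 1) with hb
  have hAb : A.mulVec (fun k ↦ W k) = b := by
    funext r
    simp only [hb, ← hW r r.2, Matrix.mulVec, dotProduct, hA, Matrix.of_apply]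
    rw [← Finset.sum_coe_sort (Finset.Icc 1 m)]
    exact Finset.sum_congr rfl fun _ _ ↦ mul_comm _ _
  have hWb : W k = ∑ r, A⁻¹ ⟨k, hk⟩ r * b r := by
    have : A⁻¹.mulVec b = fun k : Finset.Icc 1 m ↦ W k := by
      rw [← hAb, Matrix.mulVec_mulVec, Matrix.nonsing_inv_mul A hunit, Matrix.one_mulVec]
    exact (congrFun this ⟨k, hk⟩).symm
  have hbr : ∀ r, |b r| ≤ K r * (n : ℝ) ^ (δ m - 2) := fun r ↦ by
    refine (abs_rpow_sub_taylor_le (δ r) hn').trans (mul_le_mul_of_nonneg_left ?_ (hK r))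
    have hr := Finset.mem_Icc.mp r.2
    exact Real.rpow_le_rpow_of_exponent_le (by linarith) (sub_le_sub_right
      (hδ.monotoneOn hr ⟨hr.1.trans hr.2, le_rfl⟩ hr.2) 2)
  calc |W k| ≤ ∑ r, |A⁻¹ ⟨k, hk⟩ r| * (K r * (n : ℝ) ^ (δ m - 2)) := by
        rw [hWb]
        refine (Finset.abs_sum_le_sum_abs _ _).trans (Finset.sum_le_sum fun r _ ↦ ?_)
        rw [abs_mul]
        exact mul_le_mul_of_nonneg_left (hbr r) (abs_nonneg _)
    _ = (∑ r, |A⁻¹ ⟨k, hk⟩ r| * K r) * (n : ℝ) ^ (δ m - 2) := by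
        simp only [Finset.sum_mul, mul_assoc]
    _ ≤ (∑ k, ∑ r, |A⁻¹ k r| * K r + 1) * (n : ℝ) ^ (δ m - 2) := by
        gcongr
        have := Finset.single_le_sum (f := fun k ↦ ∑ r, |A⁻¹ k r| * K r)
          (fun k _ ↦ Finset.sum_nonneg fun r _ ↦ mul_nonneg (abs_nonneg _) (hK r))
          (Finset.mem_univ (⟨k, hk⟩ : Finset.Icc 1 m))
        exact this.trans (le_add_of_nonneg_right zero_le_one)

/-- Equation (2.34): bounds on the Taylor correction weights. -/
theorem taylor_weights_bound (mt mt' : ℕ) (hmt : 0 < mt) (hmt' : 0 < mt')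
    (δ σ : ℕ → ℝ)
    (hδmono : StrictMonoOn δ (Set.Icc 1 mt)) (hδpos : 0 < δ 1)
    (hσmono : StrictMonoOn σ (Set.Icc 1 mt')) (hσpos : 0 < σ 1) :
    ∃ C : ℝ, 0 < C ∧ ∀ n : ℕ, 2 ≤ n →
      (∀ W : ℕ → ℝ, IsTaylorFWeights δ mt n W →
        ∀ k ∈ Finset.Icc 1 mt, |W k| ≤ C * (n : ℝ) ^ (δ mt - 2)) ∧
      (∀ W : ℕ → ℝ, IsTaylorUWeights σ mt' n W →
        ∀ k ∈ Finset.Icc 1 mt', |W k| ≤ C * (n : ℝ) ^ (σ mt' - 2)) := by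
  obtain ⟨C, hC, hF⟩ := IsTaylorFWeights.exists_bound hδmono
  obtain ⟨C', hC', hU⟩ := IsTaylorFWeights.exists_bound hσmono
  refine ⟨max C C', lt_max_of_lt_left hC, fun n hn ↦ ⟨fun W hW k hk ↦ ?_, fun W hW k hk ↦ ?_⟩⟩
  · refine (hF n hn W hW k hk).trans ?_
    gcongr
    exact le_max_left C C'
  · have := hU n hn (-W) hW.neg k hk
    rw [Pi.neg_apply, abs_neg] at this
    refine this.trans ?_
    gcongr
    exact le_max_right C C'
end
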